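/- arXiv:2310.05353 — 9 statements merged into one kernel-verified Lean document; each statement's English description precedes it below -/
import Mathlib

section
/- Let r ≥ 2 and n ≥ d ≥ 1 be integers. If H ⊆ {1,...,r,⋆}^{[n]} is a partial class with VC(H) ≤ d, then C(H) ≤ binom(n, ≤ L), where L = log_{r/(r-1)}(Σ_{i=0}^{d} binom(n,i)). -/
/-- A set `S ⊆ [n]` is shattered by a partial class `H ⊆ {1,…,r,⋆}^[n]`
(`⋆` is encoded as `none`) if the restriction of `H` to `S` contains every
total function `S → {1,…,r}`. -/
def IsShattered (n r : ℕ) (H : Set (Fin n → Option (Fin r))) (S : Finset (Fin n)) : Prop :=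
  ∀ g : Fin n → Fin r, ∃ h ∈ H, ∀ i ∈ S, h i = some (g i)

/-- `VCDimLE n r H d` means the VC-dimension of the partial class `H` is at most `d`. -/
def VCDimLE (n r : ℕ) (H : Set (Fin n → Option (Fin r))) (d : ℕ) : Prop :=
  ∀ S : Finset (Fin n), IsShattered n r H S → S.card ≤ d

/-- A total class `F` is a net of the partial class `H` if for every `h ∈ H`
there is `f ∈ F` with `h i ≠ f i` for all `i`. -/
def IsNet {ι α : Type*} (H : Set (ι → Option α)) (F : Finset (ι → α)) : Prop :=
  ∀ h ∈ H, ∃ f ∈ F, ∀ i, h i ≠ some (f i)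

/-- The covering number `C(H)`: the minimum size of a net of `H`. -/
noncomputable def coveringNumber {ι α : Type*} (H : Set (ι → Option α)) : ℕ :=
  sInf {m | ∃ F : Finset (ι → α), IsNet H F ∧ F.card = m}

open Classical in
/-- The number of sets shattered by the partial class `H`. -/
noncomputable def shatteredCount (n r : ℕ) (H : Set (Fin n → Option (Fin r))) : ℕ :=
  (Finset.univ.filter (IsShattered n r H)).card

theorem IsShattered.mono {n r : ℕ} {H K : Set (Fin n → Option (Fin r))} {S : Finset (Fin n)}
    (hS : IsShattered n r H S) (hHK : H ⊆ K) : IsShattered n r K S := fun g ↦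
  let ⟨h, hh, hg⟩ := hS g
  ⟨h, hHK hh, hg⟩

theorem IsShattered.notMem_of_forall_eq {n r : ℕ} (hr : 2 ≤ r)
    {H : Set (Fin n → Option (Fin r))} {S : Finset (Fin n)} {x : Fin n} {y : Fin r}
    (hS : IsShattered n r H S) (hH : ∀ h ∈ H, h x = some y) : x ∉ S := by
  intro hx
  have : Nontrivial (Fin r) := Fin.nontrivial_iff_two_le.2 hr
  obtain ⟨z, hz⟩ := exists_ne y
  obtain ⟨h, hh, hg⟩ := hS fun _ ↦ z
  exact hz (Option.some_injective _ ((hg x hx).symm.trans (hH h hh)))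

theorem isShattered_insert {n r : ℕ} {H : Set (Fin n → Option (Fin r))} {S : Finset (Fin n)}
    {x : Fin n} (hS : ∀ y, IsShattered n r {h ∈ H | h x = some y} S) :
    IsShattered n r H (insert x S) := by
  intro g
  obtain ⟨h, ⟨hh, hx⟩, hg⟩ := hS (g x) g
  refine ⟨h, hh, fun i hi ↦ ?_⟩
  rcases Finset.mem_insert.1 hi with rfl | hi
  · exact hx
  · exact hg i hi

/-- Splitting a partial class by its values at one coordinate gives subclasses whose shattered
sets number, in total, at most `r - 1` times those of the whole class. -/
theorem sum_shatteredCount_le {n r : ℕ} (hr : 2 ≤ r) (H : Set (Fin n → Option (Fin r)))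
    (x : Fin n) :
    ∑ y, shatteredCount n r {h ∈ H | h x = some y} ≤ (r - 1) * shatteredCount n r H := by
  classical
  let K : Fin r → Set (Fin n → Option (Fin r)) := fun y ↦ {h ∈ H | h x = some y}
  let A := Finset.univ.filter (IsShattered n r H)
  let U := A.filter (x ∉ ·)
  let W := A.filter (x ∈ ·)
  let B := U.filter fun S ↦ ∀ y, IsShattered n r (K y) S
  have hAUW : W.card + U.card = A.card := Finset.card_filter_add_card_filter_not _
  have hBW : B.card ≤ W.card := by
    refine Finset.card_le_card_of_injOn (insert x) (fun S hS ↦ ?_) fun S hS T hT hST ↦ ?_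
    · simp only [B, Finset.coe_filter, Set.mem_ofPred_eq] at hS
      simp [W, A, isShattered_insert hS.2]
    · have hxS : x ∉ S := by simp [B, U] at hS; exact hS.1.2
      have hxT : x ∉ T := by simp [B, U] at hT; exact hT.1.2
      rw [← Finset.erase_insert hxS, ← Finset.erase_insert hxT]
      exact congrArg (Finset.erase · x) hST
  have hK : ∀ y, Finset.univ.filter (IsShattered n r (K y)) =
      U.filter fun S ↦ IsShattered n r (K y) S := by
    intro y
    ext S
    simp only [U, A, Finset.mem_filter, Finset.mem_univ, true_and]
    exact ⟨fun h ↦ ⟨⟨h.mono fun _ hh ↦ hh.1, h.notMem_of_forall_eq hr fun _ hh ↦ hh.2⟩, h⟩,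
      fun h ↦ h.2⟩
  have hfiber : ∀ S, (Finset.univ.filter fun y ↦ IsShattered n r (K y) S).card ≤
      (r - 1) + if ∀ y, IsShattered n r (K y) S then 1 else 0 := by
    intro S
    split_ifs with h
    · exact (Finset.card_le_univ _).trans (by simp; lia)
    · push Not at h
      obtain ⟨y, hy⟩ := h
      have : (Finset.univ.filter fun y ↦ IsShattered n r (K y) S) ⊆ Finset.univ.erase y := by
        intro z hz
        simp only [Finset.mem_filter, Finset.mem_univ, true_and] at hz
        simp only [Finset.mem_erase, Finset.mem_univ, and_true]
        rintro rfl
        exact hy hz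
      simpa using Finset.card_le_card this
  calc ∑ y, shatteredCount n r (K y)
      = ∑ y, (U.filter fun S ↦ IsShattered n r (K y) S).card :=
        Finset.sum_congr rfl fun y _ ↦ by rw [← hK]; unfold shatteredCount; congr
    _ = ∑ S ∈ U, (Finset.univ.filter fun y ↦ IsShattered n r (K y) S).card := by
        simp only [Finset.card_filter]
        exact Finset.sum_comm
    _ ≤ ∑ S ∈ U, ((r - 1) + if ∀ y, IsShattered n r (K y) S then 1 else 0) :=
        Finset.sum_le_sum fun S _ ↦ hfiber S
    _ = U.card * (r - 1) + B.card := by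
        simp [Finset.sum_add_distrib, B]
    _ ≤ (r - 1) * A.card := by
        have : W.card ≤ (r - 1) * W.card := Nat.le_mul_of_pos_left _ (by lia)
        rw [← hAUW]
        lia
    _ = (r - 1) * shatteredCount n r H := by unfold shatteredCount; congr

theorem exists_mul_shatteredCount_le {n r : ℕ} (hr : 2 ≤ r) (H : Set (Fin n → Option (Fin r)))
    (x : Fin n) :
    ∃ y, r * shatteredCount n r {h ∈ H | h x = some y} ≤ (r - 1) * shatteredCount n r H := by
  by_contra! hlt
  have : Nonempty (Fin r) := ⟨⟨0, by lia⟩⟩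
  have hsum := Finset.sum_lt_sum_of_nonempty (Finset.univ_nonempty (α := Fin r))
    fun y _ ↦ hlt y
  rw [Finset.sum_const, Finset.card_univ, Fintype.card_fin, smul_eq_mul, ← Finset.mul_sum] at hsum
  exact absurd (Nat.mul_le_mul_left r (sum_shatteredCount_le hr H x)) hsum.not_ge

theorem shatteredCount_pos {n r : ℕ} {H : Set (Fin n → Option (Fin r))} (hH : H.Nonempty) :
    0 < shatteredCount n r H := by
  obtain ⟨h, hh⟩ := hH
  exact Finset.card_pos.2 ⟨∅, by simpa [IsShattered] using fun _ ↦ ⟨h, hh⟩⟩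

theorem shatteredCount_le {n r d : ℕ} {H : Set (Fin n → Option (Fin r))}
    (hVC : VCDimLE n r H d) :
    shatteredCount n r H ≤ ∑ i ∈ Finset.range (d + 1), n.choose i := by
  classical
  calc shatteredCount n r H
      ≤ ((Finset.range (d + 1)).biUnion fun i ↦
          Finset.powersetCard i (Finset.univ : Finset (Fin n))).card := by
        refine Finset.card_le_card fun S hS ↦ ?_
        have := hVC S (Finset.mem_filter.1 hS).2
        simp [Finset.mem_powersetCard]
        lia
    _ ≤ ∑ i ∈ Finset.range (d + 1), n.choose i := by
        refine Finset.card_biUnion_le.trans (Finset.sum_le_sum fun i _ ↦ ?_)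
        simp

theorem sum_range_succ_choose_succ (a k : ℕ) :
    ∑ j ∈ Finset.range (k + 1), (a + 1).choose j =
      ∑ j ∈ Finset.range (k + 1), a.choose j + ∑ j ∈ Finset.range k, a.choose j := by
  rw [Finset.sum_range_succ', Finset.sum_range_succ' (fun j ↦ a.choose j)]
  simp only [Nat.choose_succ_succ, Finset.sum_add_distrib, Nat.choose_zero_right]
  lia

/-- If the number of shattered sets is below `(r / (r - 1)) ^ k`, then the class has a net on the
coordinates in `A` of size at most `∑ j < k, (#A).choose j`. -/
theorem exists_net_on {n r : ℕ} (hr : 2 ≤ r) (A : Finset (Fin n)) (k : ℕ)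
    (H : Set (Fin n → Option (Fin r)))
    (hk : shatteredCount n r H * (r - 1) ^ k < r ^ k) :
    ∃ F : Finset (Fin n → Fin r), F.card ≤ ∑ j ∈ Finset.range k, A.card.choose j ∧
      ∀ h ∈ H, ∃ f ∈ F, ∀ i ∈ A, h i ≠ some (f i) := by
  classical
  induction A using Finset.induction_on generalizing k H with
  | empty =>
    rcases H.eq_empty_or_nonempty with rfl | hH
    · exact ⟨∅, by simp⟩
    · have hpos := shatteredCount_pos hH
      obtain _ | k := k
      · simp at hk; lia
      · refine ⟨{fun _ ↦ ⟨0, by lia⟩}, ?_, by simp⟩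
        simp [Finset.sum_range_succ']
  | insert x A hx ih =>
    obtain _ | k := k
    · rcases H.eq_empty_or_nonempty with rfl | hH
      · exact ⟨∅, by simp⟩
      · have hpos := shatteredCount_pos hH
        simp at hk
        lia
    obtain ⟨y, hy⟩ := exists_mul_shatteredCount_le hr H x
    have : Nontrivial (Fin r) := Fin.nontrivial_iff_two_le.2 hr
    obtain ⟨z, hz⟩ := exists_ne y
    obtain ⟨F₀, hF₀, hF₀H⟩ := ih (k + 1) H hk
    obtain ⟨F₁, hF₁, hF₁H⟩ := ih k {h ∈ H | h x = some y} <| by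
      refine Nat.lt_of_mul_lt_mul_left (a := r) ?_
      calc r * (shatteredCount n r {h ∈ H | h x = some y} * (r - 1) ^ k)
          = r * shatteredCount n r {h ∈ H | h x = some y} * (r - 1) ^ k := by ring
        _ ≤ (r - 1) * shatteredCount n r H * (r - 1) ^ k := Nat.mul_le_mul_right _ hy
        _ = shatteredCount n r H * (r - 1) ^ (k + 1) := by ring
        _ < r ^ (k + 1) := hk
        _ = r * r ^ k := by ring
    have hupdate : ∀ (h : Fin n → Option (Fin r)) (f : Fin n → Fin r) (c : Fin r),
        h x ≠ some c → (∀ i ∈ A, h i ≠ some (f i)) →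
        ∀ i ∈ insert x A, h i ≠ some (Function.update f x c i) := by
      intro h f c hc hf i hi
      by_cases hix : i = x
      · subst hix
        simpa using hc
      · simpa [hix] using hf i (Finset.mem_of_mem_insert_of_ne hi hix)
    refine ⟨F₀.image (Function.update · x y) ∪ F₁.image (Function.update · x z), ?_,
      fun h hh ↦ ?_⟩
    · rw [Finset.card_insert_of_notMem hx, sum_range_succ_choose_succ]
      exact (Finset.card_union_le _ _).trans (add_le_add (Finset.card_image_le.trans hF₀)
        (Finset.card_image_le.trans hF₁))
    · by_cases hxy : h x = some y
      · obtain ⟨f, hf, hfh⟩ := hF₁H h ⟨hh, hxy⟩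
        refine ⟨Function.update f x z,
          Finset.mem_union_right _ (Finset.mem_image_of_mem _ hf), hupdate h f z ?_ hfh⟩
        rw [hxy]
        exact fun h ↦ hz (Option.some_injective _ h).symm
      · obtain ⟨f, hf, hfh⟩ := hF₀H h hh
        exact ⟨Function.update f x y,
          Finset.mem_union_left _ (Finset.mem_image_of_mem _ hf), hupdate h f y hxy hfh⟩

theorem coveringNumber_le {ι α : Type*} {H : Set (ι → Option α)} {F : Finset (ι → α)}
    (hF : IsNet H F) : coveringNumber H ≤ F.card :=
  Nat.sInf_le ⟨F, hF, rfl⟩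

/-- **Theorem 1.4.** Let `r ≥ 2` and `n ≥ d ≥ 1`. If `H ⊆ {1,…,r,⋆}^[n]` is a partial class
with `VC(H) ≤ d`, then `C(H) ≤ binom(n, ≤ L)` where
`L = log_{r/(r-1)} (∑_{i=0}^d binom(n,i))`. -/
theorem stmt0 (r n d : ℕ) (hr : 2 ≤ r) (hd : 1 ≤ d) (hdn : d ≤ n)
    (H : Set (Fin n → Option (Fin r))) (hVC : VCDimLE n r H d) :
    coveringNumber H ≤
      ∑ j ∈ Finset.range
        (⌊Real.logb ((r : ℝ) / ((r : ℝ) - 1))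
            (∑ i ∈ Finset.range (d + 1), (n.choose i : ℝ))⌋₊ + 1),
        n.choose j := by
  set s : ℕ := ∑ i ∈ Finset.range (d + 1), n.choose i with hs
  have hcast : (∑ i ∈ Finset.range (d + 1), (n.choose i : ℝ)) = s := by simp [hs]
  rw [hcast]
  set k := ⌊Real.logb ((r : ℝ) / ((r : ℝ) - 1)) s⌋₊ + 1 with hk
  have hr1 : (0 : ℝ) < (r : ℝ) - 1 := by
    have : (2 : ℝ) ≤ r := by exact_mod_cast hr
    linarith
  have hbase : 1 < (r : ℝ) / ((r : ℝ) - 1) := by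
    rw [one_lt_div hr1]
    linarith
  have hspos : 0 < s := by
    rw [hs, Finset.sum_range_succ']
    simp
  have hlt : s * (r - 1) ^ k < r ^ k := by
    have hlog : Real.logb ((r : ℝ) / ((r : ℝ) - 1)) s < k := by
      rw [hk]
      exact_mod_cast Nat.lt_floor_add_one _
    rw [Real.logb_lt_iff_lt_rpow hbase (by exact_mod_cast hspos), Real.rpow_natCast, div_pow,
      lt_div_iff₀ (pow_pos hr1 k)] at hlog
    have hsub : ((r - 1 : ℕ) : ℝ) = (r : ℝ) - 1 := by
      rw [Nat.cast_sub (by lia), Nat.cast_one]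
    rw [← hsub] at hlog
    exact_mod_cast hlog
  obtain ⟨F, hF, hFH⟩ := exists_net_on hr Finset.univ k H
    ((Nat.mul_le_mul_right _ (shatteredCount_le hVC)).trans_lt hlt)
  rw [Finset.card_univ, Fintype.card_fin] at hF
  refine (coveringNumber_le fun h hh ↦ ?_).trans hF
  obtain ⟨f, hf, hfh⟩ := hFH h hh
  exact ⟨f, hf, fun i ↦ hfh i (Finset.mem_univ i)⟩
end

section
/- Let r ≥ 2 and n ≥ 1 be integers, let H ⊆ {1,...,r,⋆}^{[n]} be a partial class, and let i ∈ [n]. Then (r-1)·s(H) ≥ s(H_{i→1}) + s(H_{i→2}) + ... + s(H_{i→r}). -/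
/-- The shattering strength `s(H)`: the number of subsets of `[n]` shattered by `H`. -/
noncomputable def shatterStrength (n r : ℕ) (H : Set (Fin n → Option (Fin r))) : ℕ :=
  {S : Finset (Fin n) | IsShattered n r H S}.ncard

/-- A class that is constant on a coordinate shatters no set containing that coordinate. -/
theorem IsShattered.notMem_of_fiber {n r : ℕ} (hr : 2 ≤ r) {H : Set (Fin n → Option (Fin r))}
    {i : Fin n} {j : Fin r} {S : Finset (Fin n)}
    (hS : IsShattered n r {h ∈ H | h i = some j} S) : i ∉ S := by
  intro hi
  have : Nontrivial (Fin r) := Fin.nontrivial_iff_two_le.mpr hr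
  obtain ⟨k, hk⟩ := exists_ne j
  obtain ⟨h, ⟨-, hj⟩, hg⟩ := hS fun _ => k
  have := hg i hi
  rw [hj] at this
  exact hk (Option.some.inj this).symm

/-- A set shattered by every fiber over the coordinate `i` can be enlarged by `i`. -/
theorem IsShattered.insert_of_forall_fiber {n r : ℕ} {H : Set (Fin n → Option (Fin r))}
    {i : Fin n} {S : Finset (Fin n)}
    (hS : ∀ j, IsShattered n r {h ∈ H | h i = some j} S) : IsShattered n r H (insert i S) := by
  intro g
  obtain ⟨h, ⟨hh, hi⟩, hg⟩ := hS (g i) g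
  exact ⟨h, hh, Finset.forall_mem_insert _ _ _ |>.mpr ⟨hi, hg⟩⟩

open Classical in
theorem shatterStrength_eq_card_filter (n r : ℕ) (H : Set (Fin n → Option (Fin r))) :
    shatterStrength n r H = (Finset.univ.filter fun S => IsShattered n r H S).card := by
  rw [shatterStrength, ← Set.ncard_coe_finset]
  simp

open Classical in
/-- The sets shattered by some fiber, together with the extensions by `i` of the sets shattered
by all fibers, are distinct sets shattered by the whole class. -/
theorem card_exists_fiber_add_card_forall_fiber_le {n r : ℕ} (hr : 2 ≤ r)
    (H : Set (Fin n → Option (Fin r))) (i : Fin n) :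
    (Finset.univ.filter fun S => ∃ j, IsShattered n r {h ∈ H | h i = some j} S).card +
      (Finset.univ.filter fun S => ∀ j, IsShattered n r {h ∈ H | h i = some j} S).card ≤
      shatterStrength n r H := by
  have h_notMem : ∀ S, (∀ j, IsShattered n r {h ∈ H | h i = some j} S) → i ∉ S := fun S hS =>
    (hS ⟨0, by omega⟩).notMem_of_fiber hr
  rw [shatterStrength_eq_card_filter]
  rw [← Finset.card_image_of_injOn (s := Finset.univ.filter fun S =>
    ∀ j, IsShattered n r {h ∈ H | h i = some j} S) (f := insert i), ← Finset.card_union_of_disjoint]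
  · apply Finset.card_le_card
    intro S hS
    simp only [Finset.mem_union, Finset.mem_filter_univ, Finset.mem_image] at hS ⊢
    rcases hS with ⟨j, hj⟩ | ⟨T, hT, rfl⟩
    · exact hj.mono fun h hh => hh.1
    · exact IsShattered.insert_of_forall_fiber hT
  · rw [Finset.disjoint_left]
    intro S hS hS'
    simp only [Finset.mem_filter_univ, Finset.mem_image] at hS hS'
    obtain ⟨j, hj⟩ := hS
    obtain ⟨T, -, rfl⟩ := hS'
    exact hj.notMem_of_fiber hr (Finset.mem_insert_self i T)
  · intro S hS T hT hST
    simp only [Finset.coe_filter_univ, Set.mem_ofPred_eq] at hS hT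
    rw [← Finset.erase_insert (h_notMem S hS), ← Finset.erase_insert (h_notMem T hT)]
    exact congrArg (Finset.erase · i) hST

open Classical in
theorem card_filter_le_pred_mul_add {r : ℕ} (p : Fin r → Prop) :
    (Finset.univ.filter p).card ≤
      (r - 1) * (if ∃ j, p j then 1 else 0) + (if ∀ j, p j then 1 else 0) := by
  by_cases hall : ∀ j, p j
  · have := Finset.card_filter_le (Finset.univ : Finset (Fin r)) p
    rw [Finset.card_univ, Fintype.card_fin] at this
    rcases Nat.eq_zero_or_pos r with rfl | hr
    · omega
    · rw [if_pos ⟨⟨0, hr⟩, hall _⟩, if_pos hall]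
      omega
  · by_cases hex : ∃ j, p j
    · obtain ⟨j, hj⟩ := not_forall.mp hall
      have : (Finset.univ.filter p).card < (Finset.univ : Finset (Fin r)).card :=
        Finset.card_lt_card (Finset.filter_ssubset.mpr ⟨j, Finset.mem_univ j, hj⟩)
      rw [Finset.card_univ, Fintype.card_fin] at this
      rw [if_pos hex, if_neg hall]
      omega
    · have : Finset.univ.filter p = ∅ :=
        Finset.filter_eq_empty_iff.mpr fun j _ hj => hex ⟨j, hj⟩
      simp [this]

/-- For every coordinate `i`, `(r-1)·s(H) ≥ s(H_{i→1}) + ⋯ + s(H_{i→r})`,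
where `H_{i→j} = {h ∈ H : h i = j}`. -/
theorem stmt2 (r n : ℕ) (hr : 2 ≤ r) (hn : 1 ≤ n)
    (H : Set (Fin n → Option (Fin r))) (i : Fin n) :
    ∑ j : Fin r, shatterStrength n r {h ∈ H | h i = some j} ≤
      (r - 1) * shatterStrength n r H := by
  classical
  have key := card_exists_fiber_add_card_forall_fiber_le hr H i
  set A : Fin r → Finset (Fin n) → Prop := fun j S => IsShattered n r {h ∈ H | h i = some j} S
    with hA
  calc ∑ j : Fin r, shatterStrength n r {h ∈ H | h i = some j}
      = ∑ j : Fin r, (Finset.univ.filter fun S => A j S).card :=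
        Finset.sum_congr rfl fun j _ => shatterStrength_eq_card_filter n r _
    _ = ∑ S : Finset (Fin n), (Finset.univ.filter fun j => A j S).card :=
        Finset.sum_card_bipartiteAbove_eq_sum_card_bipartiteBelow A
    _ ≤ ∑ S : Finset (Fin n),
          ((r - 1) * (if ∃ j, A j S then 1 else 0) + (if ∀ j, A j S then 1 else 0)) :=
        Finset.sum_le_sum fun S _ => card_filter_le_pred_mul_add fun j => A j S
    _ = (r - 1) * (Finset.univ.filter fun S => ∃ j, A j S).card +
          (Finset.univ.filter fun S => ∀ j, A j S).card := by
        rw [Finset.sum_add_distrib, ← Finset.mul_sum, Finset.card_filter, Finset.card_filter]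
    _ ≤ (r - 1) * (Finset.univ.filter fun S => ∃ j, A j S).card +
          (r - 1) * (Finset.univ.filter fun S => ∀ j, A j S).card :=
        Nat.add_le_add_left (Nat.le_mul_of_pos_left _ (by omega)) _
    _ ≤ (r - 1) * shatterStrength n r H := by
        rw [← Nat.mul_add]
        exact Nat.mul_le_mul_left _ key
end

section
/- Let r ≥ k ≥ 2 and n ≥ d ≥ 1 be integers. For any total class H ⊆ {1,...,r}^{[n]} with dim_k(H) ≤ d, one has |H| ≤ (k-1)^{n-d} · Σ_{i=0}^{d} binom(n-i-1, d-i) · binom(r,k)^{d-i} · r^{i}. -/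
/-- A set `S ⊆ [n]` is `k`-Natarajan shattered by a total class `H ⊆ [r]^[n]` if the
restriction of `H` to `S` contains a product `∏_{i ∈ S} Y i` where each `Y i` is a
`k`-element subset of `[r]`. -/
def NatShattered (n r k : ℕ) (H : Finset (Fin n → Fin r)) (S : Finset (Fin n)) : Prop :=
  ∃ Y : Fin n → Finset (Fin r), (∀ i ∈ S, (Y i).card = k) ∧
    ∀ g : Fin n → Fin r, (∀ i ∈ S, g i ∈ Y i) → ∃ h ∈ H, ∀ i ∈ S, h i = g i

/-- `NatDimLE n r k H d` means the `k`-Natarajan dimension of `H` is at most `d`. -/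
def NatDimLE (n r k : ℕ) (H : Finset (Fin n → Fin r)) (d : ℕ) : Prop :=
  ∀ S : Finset (Fin n), NatShattered n r k H S → S.card ≤ d

open Finset

/-- The functions on the last `n` coordinates all of whose extensions by a value in `Y` at
coordinate `0` belong to `H`. -/
def commonTails {n r : ℕ} (H : Finset (Fin (n + 1) → Fin r)) (Y : Finset (Fin r)) :
    Finset (Fin n → Fin r) :=
  {t ∈ H.image Fin.tail | ∀ y ∈ Y, (Fin.cons y t : Fin (n + 1) → Fin r) ∈ H}

theorem NatShattered.of_image_tail {n r k : ℕ} {H : Finset (Fin (n + 1) → Fin r)}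
    {S : Finset (Fin n)} (hS : NatShattered n r k (H.image Fin.tail) S) :
    NatShattered (n + 1) r k H (S.map (Fin.succEmb n)) := by
  obtain ⟨Y, hY, hg⟩ := hS
  refine ⟨Fin.cons ∅ Y, ?_, fun g hgY => ?_⟩
  · simpa using hY
  · obtain ⟨t, ht, hts⟩ := hg (Fin.tail g) (by simpa [Fin.tail] using hgY)
    obtain ⟨h, hh, rfl⟩ := mem_image.1 ht
    exact ⟨h, hh, by simpa [Fin.tail] using hts⟩

theorem NatShattered.of_commonTails {n r k : ℕ} {H : Finset (Fin (n + 1) → Fin r)}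
    {Y : Finset (Fin r)} (hYk : Y.card = k) {S : Finset (Fin n)}
    (hS : NatShattered n r k (commonTails H Y) S) :
    NatShattered (n + 1) r k H (insert 0 (S.map (Fin.succEmb n))) := by
  obtain ⟨Z, hZ, hg⟩ := hS
  refine ⟨Fin.cons Y Z, ?_, fun g hgY => ?_⟩
  · simpa using ⟨hYk, hZ⟩
  · simp only [forall_mem_insert, Fin.cons_zero, mem_map, forall_exists_index, and_imp,
      forall_apply_eq_imp_iff₂, Fin.coe_succEmb, Fin.cons_succ] at hgY
    obtain ⟨t, ht, hts⟩ := hg (Fin.tail g) hgY.2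
    exact ⟨Fin.cons (g 0) t, (mem_filter.1 ht).2 _ hgY.1, by simpa [Fin.tail] using hts⟩

theorem card_insert_zero_map_succEmb {n : ℕ} (S : Finset (Fin n)) :
    (insert 0 (S.map (Fin.succEmb n))).card = S.card + 1 := by
  rw [card_insert_of_notMem (by simp [Fin.succ_ne_zero]), card_map]

theorem NatDimLE.image_tail {n r k d : ℕ} {H : Finset (Fin (n + 1) → Fin r)}
    (hH : NatDimLE (n + 1) r k H d) : NatDimLE n r k (H.image Fin.tail) d := fun S hS => by
  simpa using hH _ hS.of_image_tail

theorem NatDimLE.commonTails {n r k d : ℕ} {H : Finset (Fin (n + 1) → Fin r)}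
    (hH : NatDimLE (n + 1) r k H (d + 1)) {Y : Finset (Fin r)} (hY : Y.card = k) :
    NatDimLE n r k (commonTails H Y) d := fun S hS => by
  simpa [card_insert_zero_map_succEmb] using hH _ (hS.of_commonTails hY)

theorem NatDimLE.commonTails_eq_empty {n r k : ℕ} {H : Finset (Fin (n + 1) → Fin r)}
    (hH : NatDimLE (n + 1) r k H 0) {Y : Finset (Fin r)} (hY : Y.card = k) :
    _root_.commonTails H Y = ∅ := by
  by_contra hne
  obtain ⟨t, ht⟩ := nonempty_iff_ne_empty.2 hne
  have hS : NatShattered n r k (_root_.commonTails H Y) ∅ :=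
    ⟨fun _ => ∅, by simp, fun _ _ => ⟨t, ht, by simp⟩⟩
  simpa using hH _ (hS.of_commonTails hY)

theorem Nat.le_pred_add_choose {k : ℕ} (hk : 1 ≤ k) (s : ℕ) : s ≤ k - 1 + s.choose k := by
  induction s with
  | zero => simp
  | succ s ih =>
    obtain ⟨j, rfl⟩ : ∃ j, k = j + 1 := ⟨k - 1, by omega⟩
    rw [Nat.choose_succ_succ']
    rcases lt_or_ge s j with h | h
    · omega
    · have := Nat.choose_pos h
      omega

theorem card_le_card_image_tail_add_sum_commonTails {n r k : ℕ} (hk : 1 ≤ k)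
    (H : Finset (Fin (n + 1) → Fin r)) :
    H.card ≤ (k - 1) * (H.image Fin.tail).card +
      ∑ Y ∈ powersetCard k univ, (commonTails H Y).card := by
  let fiber (t : Fin n → Fin r) : Finset (Fin r) :=
    {y | (Fin.cons y t : Fin (n + 1) → Fin r) ∈ H}
  have hfiber (t : Fin n → Fin r) : ({h ∈ H | Fin.tail h = t}).card ≤ (fiber t).card := by
    refine card_le_card_of_injOn (fun h => h 0) ?_ ?_
    · intro h hh
      obtain ⟨hh, rfl⟩ := mem_filter.1 hh
      simpa [fiber] using hh
    · intro a ha b hb hab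
      have ha := (mem_filter.1 ha).2
      have hb := (mem_filter.1 hb).2
      rw [← Fin.cons_self_tail a, ← Fin.cons_self_tail b, ha, hb]
      exact congrArg (fun y => (Fin.cons y t : Fin (n + 1) → Fin r)) hab
  have hsum : ∑ Y ∈ powersetCard k univ, (commonTails H Y).card =
      ∑ t ∈ H.image Fin.tail, (fiber t).card.choose k := by
    simp_rw [commonTails, card_filter]
    rw [sum_comm]
    refine sum_congr rfl fun t _ => ?_
    rw [← card_filter, ← card_powersetCard]
    congr 1
    ext Y
    simp [fiber, mem_powersetCard, subset_iff, and_comm]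
  rw [hsum, card_eq_sum_card_image Fin.tail H, mul_comm, ← smul_eq_mul, ← sum_const,
    ← sum_add_distrib]
  exact sum_le_sum fun t _ => (hfiber t).trans (Nat.le_pred_add_choose hk _)

/-- The bound of the theorem, with `q = k - 1` and `R = r.choose k`. -/
def natarajanBound (q R r n d : ℕ) : ℕ :=
  q ^ (n - d) * ∑ i ∈ range (d + 1), (n - i - 1).choose (d - i) * R ^ (d - i) * r ^ i

theorem natarajanBound_zero (q R r n : ℕ) : natarajanBound q R r n 0 = q ^ n := by
  simp [natarajanBound]

theorem natarajanBound_self (q R r n : ℕ) : natarajanBound q R r n n = r ^ n := by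
  rw [natarajanBound, sum_range_succ, sum_eq_zero]
  · simp
  · intro i hi
    rw [Nat.choose_eq_zero_of_lt (by have := mem_range.1 hi; omega)]
    simp

theorem natarajanBound_succ_succ (q R r : ℕ) {n d : ℕ} (hdn : d < n) :
    natarajanBound q R r (n + 1) (d + 1) =
      q * natarajanBound q R r n (d + 1) + R * natarajanBound q R r n d := by
  obtain ⟨m, rfl⟩ := Nat.exists_eq_add_of_lt hdn
  have hterm : ∀ i ∈ range (d + 1),
      (d + m + 1 + 1 - i - 1).choose (d + 1 - i) * R ^ (d + 1 - i) * r ^ i =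
        (d + m + 1 - i - 1).choose (d + 1 - i) * R ^ (d + 1 - i) * r ^ i +
          R * ((d + m + 1 - i - 1).choose (d - i) * R ^ (d - i) * r ^ i) := by
    intro i hi
    obtain ⟨j, rfl⟩ := Nat.exists_eq_add_of_le (Nat.lt_succ_iff.1 (mem_range.1 hi))
    rw [show i + j + m + 1 + 1 - i - 1 = j + m + 1 by omega,
      show i + j + m + 1 - i - 1 = j + m by omega, show i + j + 1 - i = j + 1 by omega,
      show i + j - i = j by omega, Nat.choose_succ_succ]
    ring
  simp only [natarajanBound]
  rw [sum_range_succ _ (d + 1), sum_range_succ _ (d + 1), sum_congr rfl hterm,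
    sum_add_distrib, ← mul_sum, show d + m + 1 + 1 - (d + 1) = m + 1 by omega,
    show d + m + 1 - (d + 1) = m by omega, show d + m + 1 - d = m + 1 by omega]
  simp only [Nat.sub_self, Nat.choose_zero_right]
  ring

theorem NatDimLE.card_le_natarajanBound {r k : ℕ} (hk : 1 ≤ k) {n d : ℕ} (hdn : d ≤ n)
    {H : Finset (Fin n → Fin r)} (hH : NatDimLE n r k H d) :
    H.card ≤ natarajanBound (k - 1) (r.choose k) r n d := by
  induction n generalizing d with
  | zero =>
    obtain rfl : d = 0 := by omega
    simpa [natarajanBound_self] using card_le_univ H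
  | succ n ih =>
    have hrec := card_le_card_image_tail_add_sum_commonTails hk H
    rcases d with _ | d
    · rw [sum_eq_zero fun Y hY => by
        rw [hH.commonTails_eq_empty (mem_powersetCard.1 hY).2, card_empty]] at hrec
      have himage := ih n.zero_le hH.image_tail
      rw [natarajanBound_zero] at himage ⊢
      rw [pow_succ']
      exact hrec.trans (Nat.mul_le_mul_left _ himage)
    rcases (Nat.le_of_succ_le_succ hdn).eq_or_lt with rfl | hlt
    · simpa [natarajanBound_self] using card_le_univ H
    · rw [natarajanBound_succ_succ _ _ _ hlt]
      refine hrec.trans (Nat.add_le_add (Nat.mul_le_mul_left _ (ih hlt hH.image_tail)) ?_)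
      refine (sum_le_card_nsmul _ _ _ fun Y hY =>
        ih hlt.le (hH.commonTails (mem_powersetCard.1 hY).2)).trans_eq ?_
      simp

/-- **Theorem 1.7.** Let `r ≥ k ≥ 2` and `n ≥ d ≥ 1`. For any total class `H ⊆ [r]^[n]`
with `dim_k(H) ≤ d`, one has
`|H| ≤ (k-1)^{n-d} ∑_{i=0}^d binom(n-i-1, d-i) binom(r,k)^{d-i} r^i`. -/
theorem stmt7 (r k n d : ℕ) (hk : 2 ≤ k) (hkr : k ≤ r) (hd : 1 ≤ d) (hdn : d ≤ n)
    (H : Finset (Fin n → Fin r)) (hdim : NatDimLE n r k H d) :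
    H.card ≤ (k - 1) ^ (n - d) *
      ∑ i ∈ Finset.range (d + 1),
        (n - i - 1).choose (d - i) * (r.choose k) ^ (d - i) * r ^ i := by
  exact hdim.card_le_natarajanBound (by omega) hdn
end

section
/- Let r ≥ k ≥ 2 and n ≥ 1 be integers, and let Ω be a set {b_1,...,b_{k-1}} ∪ {c_A : A a k-element subset of [r]}, disjoint from [r], of cardinality k-1+binom(r,k). For every total class H ⊆ [r]^{[n]} there exist classes H_0, H_1, ..., H_n of functions from [n] to [r] ∪ Ω with H_0 = H, and maps φ_1, ..., φ_n, such that: (P1) for 0 ≤ i ≤ n, every g ∈ H_i satisfies g(j) ∈ Ω for all j ≤ i and g(j) ∈ [r] for all j > i; (P2) for 1 ≤ i ≤ n, φ_i : H_{i-1} → H_i is a bijection with φ_i(g)(j) = g(j) for all j ∈ [n] with j ≠ i; (P3) every g ∈ H_n has at most dim_k(H) coordinates whose value lies in {c_A : A a k-element subset of [r]}. -/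
/-- The `k`-Natarajan dimension of `H`: the maximum size of a `k`-Natarajan shattered set
(`0` if no nonempty set is shattered). -/
noncomputable def natDim (n r k : ℕ) (H : Finset (Fin n → Fin r)) : ℕ :=
  sSup {m | ∃ S : Finset (Fin n), NatShattered n r k H S ∧ S.card = m}

/-- The alphabet `Ω = {b_1, …, b_{k-1}} ∪ {c_A : A ∈ binom([r],k)}`,
of cardinality `k - 1 + binom(r,k)`, disjoint from `[r]`. -/
def OmegaAlphabet (r k : ℕ) : Type :=
  Fin (k - 1) ⊕ {A : Finset (Fin r) // A.card = k}

/-- Every `V ⊆ [r]` can be injectively relabelled by `Ω` so that a label `c_A` is used only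
if `A ⊆ V`. -/
theorem exists_injOn_relabelling {r k : ℕ} (hk : 2 ≤ k) (V : Set (Fin r)) :
    ∃ f : Fin r → OmegaAlphabet r k, Set.InjOn f V ∧
      ∀ v ∈ V, ∀ A : {A : Finset (Fin r) // A.card = k}, f v = Sum.inr A →
        (A.1 : Set (Fin r)) ⊆ V := by
  classical
  obtain ⟨B, hBV, hBk, hB⟩ : ∃ B : Finset (Fin r), (B : Set (Fin r)) ⊆ V ∧ B.card ≤ k - 1 ∧
      (B.card = k - 1 ∨ (B : Set (Fin r)) = V) := by
    rcases le_total V.toFinset.card (k - 1) with h | h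
    · exact ⟨V.toFinset, by simp, h, Or.inr (by simp)⟩
    · obtain ⟨B, hB, hc⟩ := Finset.exists_subset_card_eq h
      exact ⟨B, fun x hx => by simpa using hB hx, hc.le, Or.inl hc⟩
  have hcard : Fintype.card B ≤ Fintype.card (Fin (k - 1)) := by simpa using hBk
  obtain ⟨e⟩ := Function.Embedding.nonempty_of_card_le hcard
  have hins : ∀ v ∈ V, v ∉ B → (insert v B).card = k := by
    intro v hv hvB
    rcases hB with h | h
    · rw [Finset.card_insert_of_notMem hvB, h]
      omega
    · exact absurd (by rw [← h] at hv; exact hv) hvB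
  let f : Fin r → OmegaAlphabet r k := fun v =>
    if h : v ∈ B then Sum.inl (e ⟨v, h⟩)
    else if h' : (insert v B).card = k then Sum.inr ⟨insert v B, h'⟩
    else Sum.inl ⟨0, by omega⟩
  have f_mem : ∀ v (h : v ∈ B), f v = Sum.inl (e ⟨v, h⟩) := fun v h => dif_pos h
  have f_notMem : ∀ v (hv : v ∈ V) (h : v ∉ B),
      f v = Sum.inr ⟨insert v B, hins v hv h⟩ := fun v hv h =>
    (dif_neg h).trans (dif_pos (hins v hv h))
  refine ⟨f, fun v hv w hw hvw => ?_, fun v hv A hA => ?_⟩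
  · by_cases h : v ∈ B <;> by_cases h' : w ∈ B
    · rw [f_mem v h, f_mem w h'] at hvw
      simpa using e.injective (Sum.inl_injective hvw)
    · rw [f_mem v h, f_notMem w hw h'] at hvw
      cases hvw
    · rw [f_notMem v hv h, f_mem w h'] at hvw
      cases hvw
    · rw [f_notMem v hv h, f_notMem w hw h'] at hvw
      have hset : insert v B = insert w B := congrArg Subtype.val (Sum.inr_injective hvw)
      have hmem : v ∈ insert w B := hset ▸ Finset.mem_insert_self v B
      exact (Finset.mem_insert.mp hmem).resolve_right h
  · by_cases h : v ∈ B
    · rw [f_mem v h] at hA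
      cases hA
    · rw [f_notMem v hv h] at hA
      rw [← Sum.inr_injective hA, Finset.coe_insert]
      exact Set.insert_subset hv hBV

/-- The values `v` for which replacing the `i`-th coordinate of `g` by `v` gives an element
of `T`. -/
def coordFiber {ι α β : Type*} [DecidableEq ι] (T : Set (ι → α ⊕ β)) (i : ι)
    (g : ι → α ⊕ β) : Set α :=
  {v | Function.update g i (Sum.inl v) ∈ T}

/-- Relabel the `i`-th coordinate of `g`, using the relabelling `F` attached to the fiber
of `T` through `g` in direction `i`. -/
def relabelCoord {ι α β : Type*} [DecidableEq ι] (F : Set α → α → β) (T : Set (ι → α ⊕ β))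
    (i : ι) (g : ι → α ⊕ β) : ι → α ⊕ β :=
  Function.update g i (Sum.elim (fun v => Sum.inr (F (coordFiber T i g) v)) Sum.inr (g i))

section relabelCoord

variable {ι α β : Type*} [DecidableEq ι] {F : Set α → α → β} {T : Set (ι → α ⊕ β)} {i : ι}

theorem relabelCoord_of_ne (g : ι → α ⊕ β) {j : ι} (h : j ≠ i) :
    relabelCoord F T i g j = g j :=
  Function.update_of_ne h _ _

theorem relabelCoord_self {g : ι → α ⊕ β} {v : α} (h : g i = Sum.inl v) :
    relabelCoord F T i g i = Sum.inr (F (coordFiber T i g) v) := by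
  simp [relabelCoord, h]

theorem mem_coordFiber_self {g : ι → α ⊕ β} (hg : g ∈ T) {v : α} (h : g i = Sum.inl v) :
    v ∈ coordFiber T i g := by
  simpa [coordFiber, ← h] using hg

theorem injOn_relabelCoord (hF : ∀ V, Set.InjOn (F V) V)
    (hT : ∀ g ∈ T, ∃ v, g i = Sum.inl v) : Set.InjOn (relabelCoord F T i) T := by
  intro g hg g' hg' h
  obtain ⟨v, hv⟩ := hT g hg
  obtain ⟨v', hv'⟩ := hT g' hg'
  have hne : ∀ j, j ≠ i → g j = g' j := fun j hj => by
    simpa only [relabelCoord_of_ne _ hj] using congrFun h j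
  have hfib : coordFiber T i g = coordFiber T i g' := by
    have hup : ∀ x, Function.update g i x = Function.update g' i x := fun x => by
      ext1 j
      by_cases hj : j = i
      · subst hj; simp
      · simp [hj, hne j hj]
    simp only [coordFiber, hup]
  have hi := congrFun h i
  rw [relabelCoord_self hv, relabelCoord_self hv', hfib] at hi
  have hvv : v = v' := hF _ (hfib ▸ mem_coordFiber_self hg hv) (mem_coordFiber_self hg' hv')
    (Sum.inr_injective hi)
  ext1 j
  by_cases hj : j = i
  · subst hj; rw [hv, hv', hvv]
  · exact hne j hj

end relabelCoord

/-- The classes obtained from `T` by relabelling the coordinates `0, 1, …` successively. -/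
def relabelTower {n : ℕ} {α β : Type*} (F : Set α → α → β) (T : Set (Fin n → α ⊕ β)) :
    ℕ → Set (Fin n → α ⊕ β)
  | 0 => T
  | m + 1 =>
    if h : m < n then relabelCoord F (relabelTower F T m) ⟨m, h⟩ '' relabelTower F T m
    else relabelTower F T m

theorem relabelTower_succ {n : ℕ} {α β : Type*} (F : Set α → α → β)
    (T : Set (Fin n → α ⊕ β)) {m : ℕ} (h : m < n) :
    relabelTower F T (m + 1) =
      relabelCoord F (relabelTower F T m) ⟨m, h⟩ '' relabelTower F T m := by
  rw [relabelTower, dif_pos h]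

theorem relabelTower_values {n : ℕ} {α β : Type*} {F : Set α → α → β}
    {T : Set (Fin n → α ⊕ β)} (hT : ∀ g ∈ T, ∀ j, ∃ v, g j = Sum.inl v) {m : ℕ} (hm : m ≤ n) :
    ∀ g ∈ relabelTower F T m, ∀ j : Fin n,
      ((j : ℕ) < m → ∃ w, g j = Sum.inr w) ∧ (m ≤ (j : ℕ) → ∃ v, g j = Sum.inl v) := by
  induction m with
  | zero => exact fun g hg j => ⟨fun h => absurd h (Nat.not_lt_zero _), fun _ => hT g hg j⟩
  | succ m ih =>
    rw [relabelTower_succ F T hm]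
    rintro _ ⟨g, hg, rfl⟩ j
    by_cases hj : j = ⟨m, hm⟩
    · subst hj
      obtain ⟨v, hv⟩ := (ih (by omega) g hg ⟨m, hm⟩).2 le_rfl
      exact ⟨fun _ => ⟨_, relabelCoord_self hv⟩, fun h => absurd h (by simp)⟩
    · have hjm : (j : ℕ) ≠ m := fun h => hj (Fin.ext h)
      rw [relabelCoord_of_ne g hj]
      exact ⟨fun h => (ih (by omega) g hg j).1 (by omega),
        fun h => (ih (by omega) g hg j).2 (by omega)⟩

/-- Any choice of values in the sets `A` labelling the coordinates of an element of the tower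
is realised by an element of the initial class. -/
theorem exists_mem_of_mem_relabelTower {n r k : ℕ} {F : Set (Fin r) → Fin r → OmegaAlphabet r k}
    (hF : ∀ V, ∀ v ∈ V, ∀ A : {A : Finset (Fin r) // A.card = k}, F V v = Sum.inr A →
      (A.1 : Set (Fin r)) ⊆ V)
    {T : Set (Fin n → Fin r ⊕ OmegaAlphabet r k)}
    (hT : ∀ g ∈ T, ∀ j, ∃ v, g j = Sum.inl v) (f : Fin n → Fin r) {m : ℕ} (hm : m ≤ n) :
    ∀ g ∈ relabelTower F T m,
      (∀ j, ∀ A : {A : Finset (Fin r) // A.card = k}, g j = Sum.inr (Sum.inr A) → f j ∈ A.1) →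
      ∃ h ∈ T, (∀ j v, g j = Sum.inl v → h j = Sum.inl v) ∧
        ∀ j, ∀ A : {A : Finset (Fin r) // A.card = k}, g j = Sum.inr (Sum.inr A) →
          h j = Sum.inl (f j) := by
  induction m with
  | zero =>
    refine fun g hg _ => ⟨g, hg, fun _ _ h => h, fun j A hA => ?_⟩
    obtain ⟨v, hv⟩ := hT g hg j
    rw [hv] at hA
    cases hA
  | succ m ih =>
    rw [relabelTower_succ F T hm]
    rintro _ ⟨g, hg, rfl⟩ hf
    set i : Fin n := ⟨m, hm⟩
    set U := relabelTower F T m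
    obtain ⟨v, hv⟩ := (relabelTower_values hT (by omega) g hg i).2 le_rfl
    have hself := relabelCoord_self (F := F) (T := U) hv
    obtain ⟨u, hu, huf⟩ : ∃ u ∈ coordFiber U i g,
        ∀ A : {A : Finset (Fin r) // A.card = k},
          F (coordFiber U i g) v = Sum.inr A → u = f i := by
      by_cases hA : ∃ A : {A : Finset (Fin r) // A.card = k},
          F (coordFiber U i g) v = Sum.inr A
      · obtain ⟨A, hA⟩ := hA
        refine ⟨f i, hF _ v (mem_coordFiber_self hg hv) A hA ?_, fun _ _ => rfl⟩
        exact hf i A (hself.trans (congrArg Sum.inr hA))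
      · exact ⟨v, mem_coordFiber_self hg hv, fun A h => absurd ⟨A, h⟩ hA⟩
    have hupd : ∀ j, j ≠ i →
        Function.update g i (Sum.inl u) j = relabelCoord F U i g j := fun j hj => by
      rw [relabelCoord_of_ne g hj, Function.update_of_ne hj]
    obtain ⟨h, hhT, hinl, hinr⟩ := ih (by omega) (Function.update g i (Sum.inl u)) hu (by
      intro j A hA
      by_cases hj : j = i
      · subst hj
        rw [Function.update_self] at hA
        cases hA
      · exact hf j A (by rw [← hupd j hj, hA]))
    refine ⟨h, hhT, fun j w hw => ?_, fun j A hA => ?_⟩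
    · by_cases hj : j = i
      · subst hj
        rw [hself] at hw
        cases hw
      · exact hinl j w (by rw [hupd j hj, hw])
    · by_cases hj : j = i
      · subst hj
        rw [hself] at hA
        rw [← huf A (Sum.inr_injective hA)]
        exact hinl _ _ (Function.update_self ..)
      · exact hinr j A (by rw [hupd j hj, hA])

theorem NatShattered.card_le_natDim {n r k : ℕ} {H : Finset (Fin n → Fin r)}
    {S : Finset (Fin n)} (hS : NatShattered n r k H S) : S.card ≤ natDim n r k H := by
  refine le_csSup ⟨n, ?_⟩ ⟨S, hS, rfl⟩
  rintro _ ⟨S', -, rfl⟩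
  simpa using S'.card_le_univ

/-- **Lemma 3.4** (the branching lemma). Let `r ≥ k ≥ 2` and `n ≥ 1`.
For every total class `H ⊆ [r]^[n]` there exist classes `H_0 = H, H_1, …, H_n` of
functions `[n] → [r] ∪ Ω` and maps `φ_1, …, φ_n` such that:
(P1) every `g ∈ H_i` takes values in `Ω` on coordinates `≤ i` and in `[r]` on
coordinates `> i`;
(P2) `φ_i : H_{i-1} → H_i` is a bijection preserving all but the `i`-th coordinate;
(P3) every `g ∈ H_n` has at most `dim_k(H)` coordinates with value in
`{c_A : A ∈ binom([r],k)}`. -/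
theorem stmt8 (r k n : ℕ) (hk : 2 ≤ k) (hkr : k ≤ r) (hn : 1 ≤ n)
    (H : Finset (Fin n → Fin r)) :
    ∃ (Hs : Fin (n + 1) → Set (Fin n → Fin r ⊕ OmegaAlphabet r k))
      (φ : Fin n → (Fin n → Fin r ⊕ OmegaAlphabet r k) → (Fin n → Fin r ⊕ OmegaAlphabet r k)),
      Hs 0 = (fun h : Fin n → Fin r => fun j => (Sum.inl (h j) : Fin r ⊕ OmegaAlphabet r k)) '' ↑H ∧
      (∀ i : Fin (n + 1), ∀ g ∈ Hs i, ∀ j : Fin n,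
        ((j : ℕ) < (i : ℕ) → ∃ w : OmegaAlphabet r k, g j = Sum.inr w) ∧
        ((i : ℕ) ≤ (j : ℕ) → ∃ v : Fin r, g j = Sum.inl v)) ∧
      (∀ i : Fin n, Set.BijOn (φ i) (Hs i.castSucc) (Hs i.succ) ∧
        ∀ g ∈ Hs i.castSucc, ∀ j : Fin n, j ≠ i → φ i g j = g j) ∧
      (∀ g ∈ Hs (Fin.last n),
        {j : Fin n | ∃ A : {A : Finset (Fin r) // A.card = k},
          g j = Sum.inr (Sum.inr A)}.ncard ≤ natDim n r k H) := by
  classical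
  choose F hFinj hFsub using exists_injOn_relabelling (r := r) hk
  set T : Set (Fin n → Fin r ⊕ OmegaAlphabet r k) :=
    (fun h : Fin n → Fin r => fun j => (Sum.inl (h j) : Fin r ⊕ OmegaAlphabet r k)) '' ↑H
  have hT : ∀ g ∈ T, ∀ j, ∃ v, g j = Sum.inl v := by
    rintro _ ⟨h, -, rfl⟩ j
    exact ⟨h j, rfl⟩
  refine ⟨fun i => relabelTower F T i, fun i => relabelCoord F (relabelTower F T i) i, rfl,
    fun i => relabelTower_values hT (Nat.lt_succ_iff.mp i.2), fun i => ⟨?_, ?_⟩, fun g hg => ?_⟩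
  · simp only [Fin.val_succ, Fin.val_castSucc, relabelTower_succ F T i.2]
    exact (injOn_relabelCoord hFinj
      fun g hg => (relabelTower_values hT i.2.le g hg i).2 le_rfl).bijOn_image
  · exact fun g _ j hj => relabelCoord_of_ne g hj
  · rw [Set.ncard_eq_toFinset_card']
    apply NatShattered.card_le_natDim
    simp only [NatShattered, Set.mem_toFinset, Set.mem_ofPred_eq]
    have hY : ∀ j, ∃ Y : Finset (Fin r), ∀ A : {A : Finset (Fin r) // A.card = k},
        g j = Sum.inr (Sum.inr A) → Y = A.1 := by
      intro j
      by_cases hA : ∃ A : {A : Finset (Fin r) // A.card = k}, g j = Sum.inr (Sum.inr A)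
      · obtain ⟨A, hA⟩ := hA
        refine ⟨A.1, fun A' hA' => ?_⟩
        rw [hA] at hA'
        rw [Sum.inr_injective (Sum.inr_injective hA')]
      · exact ⟨∅, fun A h => absurd ⟨A, h⟩ hA⟩
    choose Y hY using hY
    refine ⟨Y, ?_, fun f hf => ?_⟩
    · rintro j ⟨A, hA⟩
      rw [hY j A hA, A.2]
    · obtain ⟨_, ⟨h, hH, rfl⟩, -, hval⟩ := exists_mem_of_mem_relabelTower hFsub hT f le_rfl g hg
        fun j A hA => hY j A hA ▸ hf j ⟨A, hA⟩
      refine ⟨h, hH, ?_⟩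
      rintro j ⟨A, hA⟩
      exact Sum.inl_injective (hval j A hA)
end

section
/- Let r ≥ k ≥ 2 and n ≥ d ≥ 1 be integers, and let H = {x ∈ [r]^{[n]} : |{i ∈ [n] : x(i) > k-1}| ≤ d} be the total class of all functions having at most d coordinates with value greater than k-1. Then dim_k(H) = d and |H| = Σ_{i=0}^{d} binom(n,i) · (r-k+1)^{i} · (k-1)^{n-i}. -/
/-- The number of functions `ι → α` whose coordinates satisfying `p` are exactly those in `T`. -/
theorem card_filter_filter_eq {ι α : Type*} [Fintype ι] [DecidableEq ι] [Fintype α]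
    [DecidableEq α] (p : α → Prop) [DecidablePred p] (T : Finset ι) :
    (Finset.univ.filter (fun x : ι → α => Finset.univ.filter (fun i => p (x i)) = T)).card =
      (Finset.univ.filter p).card ^ T.card *
        (Finset.univ.filter (fun a => ¬ p a)).card ^ (Fintype.card ι - T.card) := by
  have h : Finset.univ.filter (fun x : ι → α => Finset.univ.filter (fun i => p (x i)) = T) =
      Fintype.piFinset (fun i => if i ∈ T then Finset.univ.filter p
        else Finset.univ.filter (fun a => ¬ p a)) := by
    ext x
    simp only [Finset.mem_filter, Finset.mem_univ, true_and, Fintype.mem_piFinset,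
      Finset.ext_iff]
    refine forall_congr' fun i => ?_
    by_cases hi : i ∈ T <;> simp [hi]
  rw [h, Fintype.card_piFinset]
  simp only [apply_ite Finset.card]
  rw [Finset.prod_ite, Finset.prod_const, Finset.prod_const, ← Finset.card_compl,
    Finset.filter_mem_eq_inter, Finset.univ_inter, Finset.compl_eq_univ_sdiff,
    Finset.sdiff_eq_filter]

/-- The number of functions `ι → α` with exactly `m` coordinates satisfying `p`. -/
theorem card_filter_card_filter_eq {ι α : Type*} [Fintype ι] [DecidableEq ι] [Fintype α]
    [DecidableEq α] (p : α → Prop) [DecidablePred p] (m : ℕ) :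
    (Finset.univ.filter
        (fun x : ι → α => (Finset.univ.filter (fun i => p (x i))).card = m)).card =
      (Fintype.card ι).choose m * (Finset.univ.filter p).card ^ m *
        (Finset.univ.filter (fun a => ¬ p a)).card ^ (Fintype.card ι - m) := by
  rw [Finset.card_eq_sum_card_fiberwise (f := fun x : ι → α => Finset.univ.filter (fun i => p (x i)))
    (t := Finset.powersetCard m Finset.univ) (fun x hx => by simpa using hx)]
  have h : ∀ T ∈ Finset.powersetCard m (Finset.univ : Finset ι),
      ((Finset.univ.filter (fun x : ι → α =>
        (Finset.univ.filter (fun i => p (x i))).card = m)).filter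
          (fun x => Finset.univ.filter (fun i => p (x i)) = T)).card =
      (Finset.univ.filter p).card ^ m *
        (Finset.univ.filter (fun a => ¬ p a)).card ^ (Fintype.card ι - m) := by
    intro T hT
    obtain rfl := (Finset.mem_powersetCard.mp hT).2
    rw [← card_filter_filter_eq, Finset.filter_filter]
    congr 1
    ext x
    simp only [Finset.mem_filter, Finset.mem_univ, true_and, and_iff_right_iff_imp]
    exact congrArg Finset.card
  rw [Finset.sum_congr rfl h, Finset.sum_const, Finset.card_powersetCard, Finset.card_univ,
    smul_eq_mul, mul_assoc]

theorem card_filter_val_lt {r m : ℕ} (h : m ≤ r) :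
    (Finset.univ.filter (fun a : Fin r => (a : ℕ) < m)).card = m := by
  simp [Fin.card_filter_val_lt, h]

theorem card_filter_le_val {r m : ℕ} (h : m ≤ r) :
    (Finset.univ.filter (fun a : Fin r => m ≤ (a : ℕ))).card = r - m := by
  have := Finset.card_filter_add_card_filter_not (s := (Finset.univ : Finset (Fin r)))
    (fun a : Fin r => (a : ℕ) < m)
  simp only [not_lt, card_filter_val_lt h, Finset.card_univ, Fintype.card_fin] at this
  omega

/-- A set of at least `m + 1` elements of `Fin r` contains an element of value at least `m`. -/
theorem exists_mem_le_val {r m : ℕ} {Y : Finset (Fin r)} (h : m < Y.card) :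
    ∃ a ∈ Y, m ≤ (a : ℕ) := by
  by_contra! hY
  have hle : (Y.map Fin.valEmbedding).card ≤ (Finset.range m).card :=
    Finset.card_le_card fun a ha => by
      obtain ⟨b, hb, rfl⟩ := Finset.mem_map.mp ha
      exact Finset.mem_range.mpr (hY b hb)
  rw [Finset.card_map, Finset.card_range] at hle
  omega

/-- Let `r ≥ k ≥ 2` and `n ≥ d ≥ 1`, and let `H ⊆ [r]^[n]` be the total class of all
functions having at most `d` coordinates with value greater than `k - 1` (here `[r]` is
encoded as `Fin r`, the element `x i : Fin r` representing the value `(x i : ℕ) + 1`, so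
"value greater than `k - 1`" reads `k - 1 ≤ (x i : ℕ)`). Then `dim_k(H) = d` and
`|H| = ∑_{i=0}^d binom(n,i) (r-k+1)^i (k-1)^{n-i}`. -/
theorem stmt9 (r k n d : ℕ) (hk : 2 ≤ k) (hkr : k ≤ r) (hd : 1 ≤ d) (hdn : d ≤ n)
    (H : Finset (Fin n → Fin r))
    (hH : H = Finset.univ.filter (fun x : Fin n → Fin r =>
      (Finset.univ.filter (fun i : Fin n => k - 1 ≤ (x i : ℕ))).card ≤ d)) :
    natDim n r k H = d ∧
      H.card = ∑ i ∈ Finset.range (d + 1),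
        n.choose i * (r - k + 1) ^ i * (k - 1) ^ (n - i) := by
  have mem_H : ∀ x, x ∈ H ↔ (Finset.univ.filter (fun i : Fin n => k - 1 ≤ (x i : ℕ))).card ≤ d := by
    simp [hH]
  constructor
  · refine IsGreatest.csSup_eq ⟨?_, ?_⟩
    · obtain ⟨S, -, hS⟩ := Finset.exists_subset_card_eq
        (s := (Finset.univ : Finset (Fin n))) (n := d) (by simpa using hdn)
      refine ⟨S, ⟨fun _ => Finset.univ.filter (fun a => (a : ℕ) < k),
        fun _ _ => card_filter_val_lt hkr, fun g _ => ?_⟩, hS⟩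
      refine ⟨fun i => if i ∈ S then g i else ⟨0, by omega⟩, (mem_H _).mpr ?_,
        fun i hi => if_pos hi⟩
      rw [← hS]
      refine Finset.card_le_card fun i hi => ?_
      by_contra hiS
      simp only [Finset.mem_filter, Finset.mem_univ, true_and, if_neg hiS] at hi
      omega
    · rintro _ ⟨S, ⟨Y, hY, hS⟩, rfl⟩
      have hg : ∀ i, ∃ a : Fin r, i ∈ S → a ∈ Y i ∧ k - 1 ≤ (a : ℕ) := by
        intro i
        by_cases hi : i ∈ S
        · obtain ⟨a, ha⟩ := exists_mem_le_val (m := k - 1) (Y := Y i) (by rw [hY i hi]; omega)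
          exact ⟨a, fun _ => ha⟩
        · exact ⟨⟨0, by omega⟩, fun h => absurd h hi⟩
      choose g hg using hg
      obtain ⟨h, hhH, hhg⟩ := hS g fun i hi => (hg i hi).1
      refine le_trans (Finset.card_le_card fun i hi => ?_) ((mem_H h).mp hhH)
      simpa [hhg i hi] using (hg i hi).2
  · rw [Finset.card_eq_sum_card_fiberwise
      (f := fun x : Fin n → Fin r =>
        (Finset.univ.filter (fun i : Fin n => k - 1 ≤ (x i : ℕ))).card)
      (t := Finset.range (d + 1))
      (fun x hx => by simpa [Nat.lt_succ_iff] using (mem_H x).mp hx)]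
    refine Finset.sum_congr rfl fun m hm => ?_
    have hfib : H.filter (fun x =>
          (Finset.univ.filter (fun i : Fin n => k - 1 ≤ (x i : ℕ))).card = m) =
        Finset.univ.filter (fun x : Fin n → Fin r =>
          (Finset.univ.filter (fun i : Fin n => k - 1 ≤ (x i : ℕ))).card = m) := by
      ext x
      have := Finset.mem_range.mp hm
      simp only [Finset.mem_filter, mem_H, Finset.mem_univ, true_and]
      omega
    have hcard := card_filter_card_filter_eq (ι := Fin n) (fun a : Fin r => k - 1 ≤ (a : ℕ)) m
    simp only [not_le, Fintype.card_fin, card_filter_val_lt (show k - 1 ≤ r by omega),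
      card_filter_le_val (show k - 1 ≤ r by omega)] at hcard
    rw [hfib, hcard, show r - (k - 1) = r - k + 1 by omega]
end

section
/- For all integers n ≥ d ≥ 0, one has Σ_{i=0}^{d} binom(n-i-1, d-i) · 2^{i} = Σ_{i=0}^{d} binom(n, i). -/
/-- Pascal's rule for partial row sums of binomial coefficients. -/
theorem sum_range_succ_choose_succ_s10 (n d : ℕ) :
    ∑ i ∈ Finset.range (d + 2), (n + 1).choose i =
      2 * ∑ i ∈ Finset.range (d + 1), n.choose i + n.choose (d + 1) := by
  have h := Finset.sum_range_succ (fun i => n.choose i) (d + 1)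
  rw [Finset.sum_range_succ'] at h ⊢
  simp only [Nat.choose_succ_succ', Finset.sum_add_distrib, Nat.choose_zero_right] at h ⊢
  omega

/-- For all integers `n ≥ d ≥ 0`,
`∑_{i=0}^d binom(n-i-1, d-i) · 2^i = ∑_{i=0}^d binom(n, i)`. -/
theorem stmt10 (n d : ℕ) (hdn : d ≤ n) :
    ∑ i ∈ Finset.range (d + 1), (n - i - 1).choose (d - i) * 2 ^ i =
      ∑ i ∈ Finset.range (d + 1), n.choose i := by
  induction d generalizing n with
  | zero => simp
  | succ d ih =>
    obtain ⟨n, rfl⟩ : ∃ m, n = m + 1 := ⟨n - 1, by omega⟩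
    rw [sum_range_succ_choose_succ_s10, ← ih n (by omega), Finset.sum_range_succ', Finset.mul_sum]
    congr 1
    · refine Finset.sum_congr rfl fun i _ => ?_
      rw [Nat.add_sub_add_right, Nat.add_sub_add_right, pow_succ]
      ring
    · simp
end

section
/- Let (X,T) be a topological dynamical system and let U = {U_1,...,U_r} be a clopen partition of X with r ≥ 1. Then there exists ℓ ∈ {1,...,r} such that (1/n)·log₂ p*_{X,U}(n) → log₂ ℓ as n → ∞, and moreover one of the following holds: (a) ℓ = r and p*_{X,U}(n) = r^n for all n ∈ ℕ; (b) ℓ ≤ r-1 and there exists a constant c > 0 such that ℓ^n ≤ p*_{X,U}(n) ≤ n^c · ℓ^n for all n ≥ 2. -/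
open Filter Topology
open scoped ENNReal

/-- The minimum cardinality `N(𝒰)` of a subcover chosen from the cover `𝒰` of `X`. -/
noncomputable def coverN {X : Type*} (𝒰 : Set (Set X)) : ℕ :=
  sInf {m | ∃ F : Finset (Set X), ↑F ⊆ 𝒰 ∧ ⋃₀ (F : Set (Set X)) = Set.univ ∧ F.card = m}

/-- The joint `⋁_{i ∈ S} T^{-i} U` of the preimages of the (indexed) open cover `U`
under the iterates of `T`, over a finite set `S ⊆ ℕ ∪ {0}`. -/
def joinCover {X ι : Type*} (T : X → X) (U : ι → Set X) (S : Finset ℕ) : Set (Set X) :=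
  {A | ∃ f : ℕ → ι, A = ⋂ i ∈ S, (T^[i]) ⁻¹' (U (f i))}

/-- `p*_{X,U}(n)`: the maximum of `N(⋁_{i ∈ S} T^{-i} U)` over `n`-element sets
`S ⊆ ℕ ∪ {0}`. -/
noncomputable def pstar {X ι : Type*} (T : X → X) (U : ι → Set X) (n : ℕ) : ℕ :=
  sSup {m | ∃ S : Finset ℕ, S.card = n ∧ coverN (joinCover T U S) = m}

/-- `L(U) = limsup_{n → ∞} (log₂ p*_{X,U}(n)) / (log₂ (n+1))²`, valued in `[0, ∞]`. -/
noncomputable def Lcov {X ι : Type*} (T : X → X) (U : ι → Set X) : ℝ≥0∞ :=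
  Filter.limsup
    (fun n : ℕ => ENNReal.ofReal
      (Real.logb 2 (pstar T U n) / (Real.logb 2 ((n : ℝ) + 1)) ^ 2))
    Filter.atTop

/-- `D` is shattered by `Z` with boxes of side `k`: the restriction of `Z` to `D` contains a product
of `k`-element sets. -/
def BoxShatters {α β : Type*} (Z : Set (α → β)) (k : ℕ) (D : Finset α) : Prop :=
  ∃ A : α → Finset β, (∀ a ∈ D, (A a).card = k) ∧
    ∀ g : α → β, (∀ a ∈ D, g a ∈ A a) → ∃ f ∈ Z, ∀ a ∈ D, f a = g a

open Classical in
/-- A Sauer–Shelah bound for families of functions with values in a finite set. -/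
theorem card_le_of_not_boxShatters {α β : Type*} [Fintype β] (l : ℕ) (hl : 1 ≤ l)
    (S : Finset α) : ∀ (d : ℕ) (F : Finset (α → β)),
      (∀ f ∈ F, ∀ g ∈ F, ∀ a ∉ S, f a = g a) →
      (∀ D ⊆ S, D.card = d → ¬ BoxShatters (F : Set (α → β)) (l + 1) D) →
      F.card ≤ l ^ S.card *
        (1 + Fintype.card β * 2 ^ Fintype.card β * S.card) ^ d := by
  set M := Fintype.card β * 2 ^ Fintype.card β with hM
  induction S using Finset.induction_on with
  | empty =>
    intro d F hF _
    have : F.card ≤ 1 := Finset.card_le_one.2 fun f hf g hg =>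
      funext fun a => hF f hf g hg a (Finset.notMem_empty a)
    simpa using this
  | insert a S ha ih =>
    intro d F hF hD
    rcases F.eq_empty_or_nonempty with rfl | ⟨f₀, hf₀⟩
    · simp
    rcases d with _ | d
    · refine absurd ?_ (hD ∅ (Finset.empty_subset _) rfl)
      exact ⟨fun _ => ∅, by simp, fun g _ => ⟨f₀, hf₀, by simp⟩⟩
    set b₀ := f₀ a
    set F' := F.image (fun f => Function.update f a b₀) with hF'
    set E : (α → β) → Finset β := fun x => Finset.univ.filter fun b => Function.update x a b ∈ F
      with hE
    set G : Finset β → Finset (α → β) := fun A => F'.filter fun x => A ⊆ E x with hG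
    have hagree : ∀ f ∈ F', ∀ g ∈ F', ∀ c ∉ S, f c = g c := by
      intro f hf g hg c hc
      obtain ⟨f, hfF, rfl⟩ := Finset.mem_image.1 hf
      obtain ⟨g, hgF, rfl⟩ := Finset.mem_image.1 hg
      by_cases hca : c = a
      · subst hca; simp
      · simp only [Function.update_of_ne hca]
        exact hF f hfF g hgF c (by simp [hca, hc])
    have hcard : F.card ≤ ∑ x ∈ F', (E x).card := by
      rw [← Finset.card_sigma]
      refine Finset.card_le_card_of_injOn
        (fun f => (⟨Function.update f a b₀, f a⟩ : Σ _ : α → β, β)) ?_ ?_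
      · intro f hf
        have hf : f ∈ F := hf
        simp only [Finset.coe_sigma, Set.mem_sigma_iff, Finset.mem_coe]
        refine ⟨Finset.mem_image_of_mem _ hf, ?_⟩
        simp [hE, hf]
      · intro f _ g _ hfg
        simp only [Sigma.mk.injEq, heq_eq_eq] at hfg
        funext c
        by_cases hca : c = a
        · subst hca; exact hfg.2
        · simpa [Function.update_of_ne hca] using congrFun hfg.1 c
    have hfib : ∀ x ∈ F', (E x).card ≤
        l + Fintype.card β * ∑ A ∈ Finset.univ.filter (fun A : Finset β => A.card = l + 1),
          (if A ⊆ E x then 1 else 0) := by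
      intro x _
      by_cases hx : (E x).card ≤ l
      · exact hx.trans (Nat.le_add_right _ _)
      · obtain ⟨A, hA, hAc⟩ := Finset.exists_subset_card_eq (Nat.lt_of_not_le hx)
        have h1 : (1 : ℕ) ≤
            ∑ A ∈ Finset.univ.filter (fun A : Finset β => A.card = l + 1),
              (if A ⊆ E x then 1 else 0) := by
          have := Finset.single_le_sum
            (f := fun A : Finset β => if A ⊆ E x then 1 else 0) (fun _ _ => Nat.zero_le _)
            (show A ∈ Finset.univ.filter (fun A : Finset β => A.card = l + 1) by simp [hAc])
          simpa [hA] using this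
        have h2 : (E x).card ≤ Fintype.card β := Finset.card_le_univ _
        nlinarith
    have hsum : F.card ≤ l * F'.card +
        Fintype.card β * ∑ A ∈ Finset.univ.filter (fun A : Finset β => A.card = l + 1),
          (G A).card := by
      refine hcard.trans ((Finset.sum_le_sum hfib).trans (le_of_eq ?_))
      rw [Finset.sum_add_distrib, ← Finset.mul_sum, Finset.sum_comm]
      simp only [hG, Finset.sum_boole, Finset.sum_const, smul_eq_mul, Nat.cast_id, mul_comm]
    have hF'b : F'.card ≤ l ^ S.card * (1 + M * S.card) ^ (d + 1) := by
      refine ih (d + 1) F' hagree fun D hDS hDc hsh => hD D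
        (hDS.trans (Finset.subset_insert _ _)) hDc ?_
      obtain ⟨A, hA, h⟩ := hsh
      refine ⟨A, hA, fun g hg => ?_⟩
      obtain ⟨f, hf, hfg⟩ := h g hg
      obtain ⟨f, hfF, rfl⟩ := Finset.mem_image.1 (Finset.mem_coe.1 hf)
      refine ⟨f, hfF, fun c hc => ?_⟩
      have hca : c ≠ a := fun h => ha (h ▸ hDS hc)
      simpa [Function.update_of_ne hca] using hfg c hc
    have hGb : ∀ A ∈ Finset.univ.filter (fun A : Finset β => A.card = l + 1),
        (G A).card ≤ l ^ S.card * (1 + M * S.card) ^ d := by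
      intro B hB
      have hB : B.card = l + 1 := by simpa using hB
      refine ih d (G B) (fun f hf g hg => hagree f (Finset.mem_of_mem_filter f hf) g
        (Finset.mem_of_mem_filter g hg)) fun D hDS hDc hsh => ?_
      have haD : a ∉ D := fun h => ha (hDS h)
      refine hD (insert a D) (Finset.insert_subset_insert a hDS)
        (by rw [Finset.card_insert_of_notMem haD, hDc]) ?_
      obtain ⟨A, hA, h⟩ := hsh
      refine ⟨Function.update A a B, ?_, fun g hg => ?_⟩
      · intro c hc
        by_cases hca : c = a
        · subst hca; simpa using hB
        · rw [Function.update_of_ne hca]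
          exact hA c (Finset.mem_of_mem_insert_of_ne hc hca)
      · obtain ⟨f, hf, hfg⟩ := h g fun c hc => by
          have hca : c ≠ a := fun h => haD (h ▸ hc)
          simpa [Function.update_of_ne hca] using hg c (Finset.mem_insert_of_mem hc)
        have hfE : B ⊆ E f := (Finset.mem_filter.1 (Finset.mem_coe.1 hf)).2
        have hgB : g a ∈ B := by simpa using hg a (Finset.mem_insert_self a D)
        refine ⟨Function.update f a (g a), (Finset.mem_filter.1 (hfE hgB)).2, fun c hc => ?_⟩
        by_cases hca : c = a
        · subst hca; simp
        · rw [Function.update_of_ne hca]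
          exact hfg c (Finset.mem_of_mem_insert_of_ne hc hca)
    have hGsum : ∑ A ∈ Finset.univ.filter (fun A : Finset β => A.card = l + 1), (G A).card ≤
        2 ^ Fintype.card β * (l ^ S.card * (1 + M * S.card) ^ d) := by
      refine (Finset.sum_le_card_nsmul _ _ _ hGb).trans ?_
      rw [smul_eq_mul]
      refine Nat.mul_le_mul_right _ ((Finset.card_le_univ _).trans ?_)
      simp
    rw [Finset.card_insert_of_notMem ha]
    calc F.card ≤ l * (l ^ S.card * (1 + M * S.card) ^ (d + 1)) +
          Fintype.card β * (2 ^ Fintype.card β * (l ^ S.card * (1 + M * S.card) ^ d)) := by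
            refine hsum.trans ?_
            gcongr
      _ = l ^ (S.card + 1) * (1 + M * S.card) ^ (d + 1) +
          1 * l ^ S.card * (M * (1 + M * S.card) ^ d) := by rw [hM]; ring
      _ ≤ l ^ (S.card + 1) * (1 + M * S.card) ^ (d + 1) +
          l * l ^ S.card * (M * (1 + M * S.card) ^ d) := by gcongr
      _ = l ^ (S.card + 1) * ((1 + M * S.card) ^ d * (1 + M * (S.card + 1))) := by ring
      _ ≤ l ^ (S.card + 1) *
          ((1 + M * (S.card + 1)) ^ d * (1 + M * (S.card + 1))) := by gcongr; omega
      _ = _ := by rw [← pow_succ]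

/-- The Sauer–Shelah bound for the restriction of a family of functions to a finite set. -/
theorem ncard_restrict_image_le {α β : Type*} [Fintype β] (Z : Set (α → β)) {l d : ℕ}
    (hl : 1 ≤ l) (hd : ∀ D : Finset α, D.card = d → ¬ BoxShatters Z (l + 1) D) (S : Finset α) :
    (S.restrict '' Z).ncard ≤
      l ^ S.card * (1 + Fintype.card β * 2 ^ Fintype.card β * S.card) ^ d := by
  classical
  rw [Set.ncard_eq_toFinset_card' (S.restrict '' Z)]
  have := card_le_of_not_boxShatters l hl (Finset.univ : Finset S) d
    (S.restrict '' Z).toFinset (by simp) ?_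
  · simpa using this
  rintro D - hDc ⟨A, hA, h⟩
  refine hd (D.map (Function.Embedding.subtype _)) (by simpa using hDc) ?_
  refine ⟨fun a => if ha : a ∈ S then A ⟨a, ha⟩ else ∅, ?_, fun g hg => ?_⟩
  · intro a ha
    obtain ⟨b, hb, rfl⟩ := Finset.mem_map.1 ha
    simpa using hA b hb
  · obtain ⟨f, hf, hfg⟩ := h (S.restrict g) fun b hb => by
      simpa using hg b (Finset.mem_map.2 ⟨b, hb, rfl⟩)
    rw [Set.coe_toFinset] at hf
    obtain ⟨z, hz, rfl⟩ := hf
    refine ⟨z, hz, fun a ha => ?_⟩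
    obtain ⟨b, hb, rfl⟩ := Finset.mem_map.1 ha
    exact hfg b hb

theorem BoxShatters.pow_card_le_ncard {α β : Type*} [Finite β] [Nonempty β] {Z : Set (α → β)}
    {k : ℕ} {D : Finset α} (h : BoxShatters Z k D) : k ^ D.card ≤ (D.restrict '' Z).ncard := by
  classical
  obtain ⟨A, hA, h⟩ := h
  have hcard : (Fintype.piFinset fun a : D => A a).card = k ^ D.card := by
    rw [Fintype.card_piFinset, Finset.prod_congr rfl fun (a : D) _ => hA a a.2]
    simp
  rw [← hcard, ← Set.ncard_coe_finset]
  refine Set.ncard_le_ncard ?_ (Set.toFinite _)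
  intro g hg
  have hg : ∀ a : D, g a ∈ A a := Fintype.mem_piFinset.1 hg
  obtain ⟨f, hf, hfg⟩ := h
    (fun a => if ha : a ∈ D then g ⟨a, ha⟩ else Classical.arbitrary β) fun a ha => by
      simpa [ha] using hg ⟨a, ha⟩
  refine ⟨f, hf, funext fun a => ?_⟩
  simpa using hfg a a.2

/-- For a partition with coding map `φ`, `N(⋁_{i ∈ S} T^{-i} U)` counts the `S`-itineraries. -/
theorem coverN_joinCover {X ι : Type*} [Nonempty X] [Finite ι] [Nonempty ι] (T : X → X) (U : ι → Set X)
    (φ : X → ι) (hφ : ∀ x i, x ∈ U i ↔ φ x = i) (S : Finset ℕ) :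
    coverN (joinCover T U S) =
      (S.restrict '' Set.range fun (x : X) (n : ℕ) => φ (T^[n] x)).ncard := by
  classical
  set Z : Set (ℕ → ι) := Set.range fun (x : X) (n : ℕ) => φ (T^[n] x)
  have hfin : (S.restrict '' Z).Finite := Set.toFinite _
  have hmem : ∀ (x : X) (f : ℕ → ι),
      x ∈ (⋂ i ∈ S, (T^[i]) ⁻¹' (U (f i))) ↔ ∀ i ∈ S, φ (T^[i] x) = f i := by
    intro x f
    simp [hφ]
  set cell : (S → ι) → Set X := fun g =>
    ⋂ i ∈ S, (T^[i]) ⁻¹' (U (if h : i ∈ S then g ⟨i, h⟩ else Classical.arbitrary ι))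
  have hex : ∃ m ≤ (S.restrict '' Z).ncard, m ∈ {m | ∃ F : Finset (Set X),
      ↑F ⊆ joinCover T U S ∧ ⋃₀ (F : Set (Set X)) = Set.univ ∧ F.card = m} := by
    refine ⟨(hfin.toFinset.image cell).card, ?_, _, ?_, ?_, rfl⟩
    · rw [Set.ncard_eq_toFinset_card _ hfin]
      exact Finset.card_image_le
    · intro A hA
      obtain ⟨g, -, rfl⟩ := Finset.mem_image.1 (Finset.mem_coe.1 hA)
      exact ⟨_, rfl⟩
    · refine Set.eq_univ_of_forall fun x => ?_
      refine ⟨cell (S.restrict fun n => φ (T^[n] x)), ?_, ?_⟩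
      · exact Finset.mem_coe.2 (Finset.mem_image_of_mem _
          (hfin.mem_toFinset.2 ⟨_, ⟨x, rfl⟩, rfl⟩))
      · rw [hmem]
        intro i hi
        simp [hi]
  obtain ⟨m, hm, hmS⟩ := hex
  refine le_antisymm ((Nat.sInf_le hmS).trans hm) ?_
  obtain ⟨F, hF, hFc, hcard⟩ := Nat.sInf_mem ⟨m, hmS⟩
  unfold coverN
  rw [← hcard, ← Set.ncard_coe_finset]
  have hpick : ∀ g ∈ S.restrict '' Z, ∃ A ∈ F, ∃ x ∈ A, S.restrict (fun n => φ (T^[n] x)) = g := by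
    rintro _ ⟨_, ⟨x, rfl⟩, rfl⟩
    obtain ⟨A, hA, hx⟩ : x ∈ ⋃₀ (F : Set (Set X)) := hFc ▸ Set.mem_univ x
    exact ⟨A, hA, x, hx, rfl⟩
  choose! A hAF x hxA hx using hpick
  refine Set.ncard_le_ncard_of_injOn A hAF ?_ F.finite_toSet
  intro g hg g' hg' hgg
  obtain ⟨f, hf⟩ := hF (hAF g hg)
  have h1 := (hmem (x g) f).1 (hf ▸ hxA g hg)
  have h2 := (hmem (x g') f).1 (hf ▸ hgg ▸ hxA g' hg')
  rw [← hx g hg, ← hx g' hg']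
  funext i
  exact (h1 i i.2).trans (h2 i i.2).symm

/-- A sequence between `ℓ ^ n` and `n ^ c * ℓ ^ n` has exponential growth rate `ℓ`. -/
theorem tendsto_logb_div_of_pow_le {p : ℕ → ℕ} {l : ℕ} (hl : 1 ≤ l) {c : ℝ}
    (h : ∀ n : ℕ, 2 ≤ n → l ^ n ≤ p n ∧ (p n : ℝ) ≤ (n : ℝ) ^ c * (l : ℝ) ^ n) :
    Tendsto (fun n : ℕ => Real.logb 2 (p n) / (n : ℝ)) atTop (nhds (Real.logb 2 l)) := by
  have hl0 : (0 : ℝ) < l := by exact_mod_cast hl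
  have hlog : Tendsto (fun n : ℕ => Real.log n / (n : ℝ)) atTop (nhds 0) :=
    (Real.isLittleO_log_id_atTop.tendsto_div_nhds_zero).comp tendsto_natCast_atTop_atTop
  have hup : Tendsto (fun n : ℕ => c / Real.log 2 * (Real.log n / (n : ℝ)) + Real.logb 2 l) atTop
      (nhds (Real.logb 2 l)) := by
    simpa using (hlog.const_mul (c / Real.log 2)).add_const (Real.logb 2 l)
  refine tendsto_of_tendsto_of_tendsto_of_le_of_le' tendsto_const_nhds hup ?_ ?_
  · filter_upwards [eventually_ge_atTop 2] with n hn
    have hn0 : (0 : ℝ) < n := by exact_mod_cast (by omega : 0 < n)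
    rw [le_div_iff₀ hn0, mul_comm, ← Real.logb_pow]
    exact Real.logb_le_logb_of_le one_lt_two (by positivity) (by exact_mod_cast (h n hn).1)
  · filter_upwards [eventually_ge_atTop 2] with n hn
    have hn0 : (0 : ℝ) < n := by exact_mod_cast (by omega : 0 < n)
    have hp : (0 : ℝ) < p n := by
      exact_mod_cast (Nat.pow_pos (by omega : 0 < l)).trans_le (h n hn).1
    have := Real.logb_le_logb_of_le one_lt_two hp (h n hn).2
    rw [Real.logb_mul (by positivity) (by positivity), Real.logb_pow,
      Real.logb_rpow_eq_mul_logb_of_pos hn0] at this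
    rw [div_le_iff₀ hn0]
    refine this.trans (le_of_eq ?_)
    unfold Real.logb
    field_simp

theorem one_add_mul_pow_le_rpow (M d n : ℕ) (hn : 2 ≤ n) :
    (((1 + M * n) ^ d : ℕ) : ℝ) ≤ (n : ℝ) ^ (((M + 1) * d + 1 : ℕ) : ℝ) := by
  rw [Real.rpow_natCast]
  norm_cast
  have h1 : 1 + M * n ≤ n ^ (M + 1) := by
    have h2 : M + 1 ≤ 2 ^ M := M.lt_two_pow_self
    calc 1 + M * n ≤ (M + 1) * n := by nlinarith
      _ ≤ n ^ M * n := by gcongr; exact h2.trans (Nat.pow_le_pow_left hn M)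
      _ = n ^ (M + 1) := (pow_succ _ _).symm
  calc (1 + M * n) ^ d ≤ (n ^ (M + 1)) ^ d := Nat.pow_le_pow_left h1 d
    _ = n ^ ((M + 1) * d) := (pow_mul _ _ _).symm
    _ ≤ n ^ ((M + 1) * d + 1) := Nat.pow_le_pow_right (by omega) (Nat.le_succ _)

/-- **Theorem 1.6.** Let `(X,T)` be a topological dynamical system and let
`U = {U 0, …, U (r-1)}` (`r ≥ 1`) be a clopen partition of `X`. Then there is
`ℓ ∈ {1,…,r}` with `(1/n)·log₂ p*_{X,U}(n) → log₂ ℓ`, and moreover either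
(a) `ℓ = r` and `p*_{X,U}(n) = r^n` for all `n ≥ 1`, or
(b) `ℓ ≤ r - 1` and there is `c > 0` with `ℓ^n ≤ p*_{X,U}(n) ≤ n^c·ℓ^n` for all `n ≥ 2`. -/
theorem stmt12 {X : Type*} [TopologicalSpace X] [CompactSpace X]
    [TopologicalSpace.MetrizableSpace X] [Nonempty X]
    (T : X → X) (hT : Continuous T) (r : ℕ) (hr : 1 ≤ r) (U : Fin r → Set X)
    (hclopen : ∀ i, IsClopen (U i))
    (hdisj : ∀ i j : Fin r, i ≠ j → Disjoint (U i) (U j))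
    (hcover : ⋃ i, U i = Set.univ) :
    ∃ ℓ : ℕ, 1 ≤ ℓ ∧ ℓ ≤ r ∧
      Tendsto (fun n : ℕ => Real.logb 2 (pstar T U n) / (n : ℝ)) atTop
        (nhds (Real.logb 2 ℓ)) ∧
      ((ℓ = r ∧ ∀ n : ℕ, 1 ≤ n → pstar T U n = r ^ n) ∨
       (ℓ ≤ r - 1 ∧ ∃ c : ℝ, 0 < c ∧ ∀ n : ℕ, 2 ≤ n →
          ℓ ^ n ≤ pstar T U n ∧ (pstar T U n : ℝ) ≤ (n : ℝ) ^ c * (ℓ : ℝ) ^ n)) := by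
  classical
  have : Nonempty (Fin r) := ⟨⟨0, hr⟩⟩
  have hmem : ∀ x, ∃ i, x ∈ U i := fun x => Set.mem_iUnion.1 (hcover ▸ Set.mem_univ x)
  choose φ hφU using hmem
  have hφ : ∀ x i, x ∈ U i ↔ φ x = i := fun x i =>
    ⟨fun hx => by_contra fun hne => Set.disjoint_left.1 (hdisj _ _ hne) (hφU x) hx,
      fun h => h ▸ hφU x⟩
  set Z : Set (ℕ → Fin r) := Set.range fun (x : X) (n : ℕ) => φ (T^[n] x) with hZ
  have hpstar : ∀ n, pstar T U n =
      sSup {m | ∃ S : Finset ℕ, S.card = n ∧ (S.restrict '' Z).ncard = m} := by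
    intro n
    simp only [pstar, coverN_joinCover T U φ hφ, hZ]
  have hncard : ∀ S : Finset ℕ, (S.restrict '' Z).ncard ≤ r ^ S.card := by
    intro S
    refine (Set.ncard_le_card _).trans (le_of_eq ?_)
    simp
  have hle : ∀ S : Finset ℕ, (S.restrict '' Z).ncard ≤ pstar T U S.card := by
    intro S
    rw [hpstar]
    refine le_csSup ⟨r ^ S.card, ?_⟩ ⟨S, rfl, rfl⟩
    rintro _ ⟨S', hS', rfl⟩
    exact hS' ▸ hncard S'
  have hge : ∀ n B, (∀ S : Finset ℕ, S.card = n → (S.restrict '' Z).ncard ≤ B) →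
      pstar T U n ≤ B := by
    intro n B h
    rw [hpstar]
    refine csSup_le ⟨_, Finset.range n, Finset.card_range n, rfl⟩ ?_
    rintro _ ⟨S, hS, rfl⟩
    exact h S hS
  set P : ℕ → Prop := fun k => ∀ n, ∃ D : Finset ℕ, D.card = n ∧ BoxShatters Z k D with hP
  have hP1 : P 1 := by
    intro n
    obtain ⟨z, hz⟩ : Z.Nonempty := Set.range_nonempty _
    refine ⟨Finset.range n, Finset.card_range n, fun a => {z a}, by simp, fun g hg => ?_⟩
    exact ⟨z, hz, fun a ha => (Finset.mem_singleton.1 (hg a ha)).symm⟩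
  set l := Nat.findGreatest P r with hldef
  have hl1 : 1 ≤ l := Nat.le_findGreatest hr hP1
  have hlr : l ≤ r := Nat.findGreatest_le r
  have hPl : P l := Nat.findGreatest_spec hr hP1
  have hlow : ∀ n, l ^ n ≤ pstar T U n := by
    intro n
    obtain ⟨D, rfl, hD⟩ := hPl n
    exact hD.pow_card_le_ncard.trans (hle D)
  rcases hlr.eq_or_lt with heq | hlt
  · have hpow : ∀ n, pstar T U n = r ^ n := fun n =>
      le_antisymm (hge n _ fun S hS => hS ▸ hncard S) ((congrArg (· ^ n) heq).symm.trans_le (hlow n))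
    refine ⟨l, hl1, hlr, tendsto_logb_div_of_pow_le (c := 0) hl1 fun n _ => ⟨hlow n, ?_⟩,
      Or.inl ⟨heq, fun n _ => hpow n⟩⟩
    simp [hpow, heq]
  · have hnot : ¬ P (l + 1) := Nat.findGreatest_is_greatest (Nat.lt_succ_self l) hlt
    obtain ⟨d, hd⟩ : ∃ d, ∀ D : Finset ℕ, D.card = d → ¬ BoxShatters Z (l + 1) D := by
      simpa [hP] using hnot
    have hbound : ∀ n : ℕ, 2 ≤ n → l ^ n ≤ pstar T U n ∧
        (pstar T U n : ℝ) ≤ (n : ℝ) ^ (((r * 2 ^ r + 1) * d + 1 : ℕ) : ℝ) * (l : ℝ) ^ n := by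
      refine fun n hn => ⟨hlow n, ?_⟩
      have h1 : pstar T U n ≤ l ^ n * (1 + r * 2 ^ r * n) ^ d := hge n _ fun S hS => by
        simpa [hS] using ncard_restrict_image_le Z hl1 hd S
      calc (pstar T U n : ℝ) ≤ ((l ^ n * (1 + r * 2 ^ r * n) ^ d : ℕ) : ℝ) := by
            exact_mod_cast h1
        _ = (((1 + r * 2 ^ r * n) ^ d : ℕ) : ℝ) * (l : ℝ) ^ n := by
            rw [Nat.cast_mul, Nat.cast_pow l, mul_comm]
        _ ≤ _ := mul_le_mul_of_nonneg_right (one_add_mul_pow_le_rpow _ _ _ hn) (by positivity)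
    exact ⟨l, hl1, hlr, tendsto_logb_div_of_pow_le hl1 hbound,
      Or.inr ⟨by omega, _, by positivity, hbound⟩⟩
end

section
/- Let (X,T) be a topological dynamical system that is null, i.e., for every finite open cover U of X, (1/n)·log₂ p*_{X,U}(n) → 0 as n → ∞. Then for every finite open cover U of X there exists a constant c = c(U) > 0 such that p*_{X,U}(n) ≤ n^{c·log₂ n} for every n ≥ 2. -/
open Filter Topology
open scoped ENNReal

/-- A finite set `B` of indices is shattered by `P` inside `Y` if every pattern on `B` is realized
by a point of `Y`. -/
def PatternShatters {X α : Type*} (P : α → Bool → Set X) (Y : Set X) (B : Finset α) : Prop :=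
  ∀ σ : α → Bool, ∃ x ∈ Y, ∀ j ∈ B, x ∈ P j (σ j)

open Classical in
/-- The subsets of `S` that are shattered by `P` inside `Y`. -/
noncomputable def shatteredSubsets {X α : Type*} (P : α → Bool → Set X) (Y : Set X)
    (S : Finset α) : Finset (Finset α) :=
  S.powerset.filter (PatternShatters P Y)

section Combinatorics

variable {X α : Type*} {P : α → Bool → Set X}

lemma PatternShatters.mono {Y Z : Set X} {B : Finset α} (h : PatternShatters P Y B)
    (hYZ : Y ⊆ Z) : PatternShatters P Z B := fun σ =>
  let ⟨x, hx, h'⟩ := h σ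
  ⟨x, hYZ hx, h'⟩

lemma notMem_of_patternShatters_inter (hP : ∀ j, Disjoint (P j false) (P j true))
    {Y : Set X} {B : Finset α} {j : α} {b : Bool}
    (h : PatternShatters P (Y ∩ P j b) B) : j ∉ B := by
  intro hj
  obtain ⟨x, hx, h'⟩ := h fun _ => !b
  have h1 := hx.2
  have h2 := h' j hj
  have hd := Set.disjoint_left.1 (hP j)
  cases b
  · exact hd h1 h2
  · exact hd h2 h1

open Classical in
lemma card_shatteredSubsets_inter_add_le (hP : ∀ j, Disjoint (P j false) (P j true))
    (Y : Set X) {S : Finset α} {j : α} (hj : j ∈ S) :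
    (shatteredSubsets P (Y ∩ P j false) S).card + (shatteredSubsets P (Y ∩ P j true) S).card
      ≤ (shatteredSubsets P Y S).card := by
  set A := shatteredSubsets P (Y ∩ P j false) S with hA
  set B := shatteredSubsets P (Y ∩ P j true) S with hB
  have memA : ∀ C ∈ A, C ⊆ S ∧ PatternShatters P (Y ∩ P j false) C := fun C hC => by
    simpa [hA, shatteredSubsets] using hC
  have memB : ∀ C ∈ B, C ⊆ S ∧ PatternShatters P (Y ∩ P j true) C := fun C hC => by
    simpa [hB, shatteredSubsets] using hC
  have hjA : ∀ C ∈ A, j ∉ C := fun C hC => notMem_of_patternShatters_inter hP (memA C hC).2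
  have hjB : ∀ C ∈ B, j ∉ C := fun C hC => notMem_of_patternShatters_inter hP (memB C hC).2
  have hinj : Set.InjOn (insert j) (↑(A ∩ B) : Set (Finset α)) := by
    intro C hC D hD hCD
    have hC' := hjA C (Finset.mem_inter.1 hC).1
    have hD' := hjA D (Finset.mem_inter.1 hD).1
    rw [← Finset.erase_insert hC', ← Finset.erase_insert hD', hCD]
  rw [← Finset.card_union_add_card_inter, ← Finset.card_image_of_injOn hinj,
    ← Finset.card_union_of_disjoint]
  · refine Finset.card_le_card fun C hC => ?_
    simp only [shatteredSubsets, Finset.mem_filter, Finset.mem_powerset]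
    rcases Finset.mem_union.1 hC with hC | hC
    · rcases Finset.mem_union.1 hC with hC | hC
      · exact ⟨(memA C hC).1, (memA C hC).2.mono Set.inter_subset_left⟩
      · exact ⟨(memB C hC).1, (memB C hC).2.mono Set.inter_subset_left⟩
    · obtain ⟨D, hD, rfl⟩ := Finset.mem_image.1 hC
      obtain ⟨hDA, hDB⟩ := Finset.mem_inter.1 hD
      refine ⟨Finset.insert_subset hj (memA D hDA).1, fun σ => ?_⟩
      have key : ∃ x ∈ Y ∩ P j (σ j), ∀ i ∈ D, x ∈ P i (σ i) := by
        cases σ j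
        · exact (memA D hDA).2 σ
        · exact (memB D hDB).2 σ
      obtain ⟨x, hx, hx'⟩ := key
      exact ⟨x, hx.1, fun i hi => (Finset.mem_insert.1 hi).elim (fun h => h ▸ hx.2) (hx' i)⟩
  · refine Finset.disjoint_left.2 fun C hC hC' => ?_
    obtain ⟨D, -, rfl⟩ := Finset.mem_image.1 hC'
    rcases Finset.mem_union.1 hC with hC | hC
    · exact hjA _ hC (Finset.mem_insert_self j D)
    · exact hjB _ hC (Finset.mem_insert_self j D)

lemma eq_empty_of_card_shatteredSubsets_lt_one {Y : Set X} {S : Finset α}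
    (h : (shatteredSubsets P Y S).card < 1) : Y = ∅ := by
  by_contra hY
  obtain ⟨y, hy⟩ := Set.nonempty_iff_ne_empty.2 hY
  have hmem : ∅ ∈ shatteredSubsets P Y S := by
    simpa [shatteredSubsets, PatternShatters] using ⟨y, hy⟩
  have := Finset.card_pos.2 ⟨_, hmem⟩
  omega

open Classical in
/-- If fewer than `2 ^ k` subsets of `S` are shattered, then the partial functions given by the
points of `Y` extend to at most `(|R| + 1) ^ k` total functions on `R ⊆ S`. -/
lemma exists_extension_family (hP : ∀ j, Disjoint (P j false) (P j true)) (S : Finset α)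
    {R : Finset α} (hR : R ⊆ S) (k : ℕ) (Y : Set X)
    (hk : (shatteredSubsets P Y S).card < 2 ^ k) :
    ∃ Φ : Finset (α → Bool), Φ.card ≤ (R.card + 1) ^ k ∧
      ∀ y ∈ Y, ∃ f ∈ Φ, ∀ j ∈ R, y ∉ P j (!f j) := by
  induction R using Finset.induction_on generalizing k Y with
  | empty => exact ⟨{fun _ => true}, by simp, by simp⟩
  | insert j R hjR ih =>
    have hRS : R ⊆ S := (Finset.subset_insert j R).trans hR
    have hjS : j ∈ S := hR (Finset.mem_insert_self j R)
    cases k with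
    | zero =>
      have := eq_empty_of_card_shatteredSubsets_lt_one (by simpa using hk)
      exact ⟨∅, by simp, by simp [this]⟩
    | succ k =>
      have hsum := card_shatteredSubsets_inter_add_le hP Y hjS
      obtain ⟨b, hb⟩ : ∃ b, (shatteredSubsets P (Y ∩ P j (!b)) S).card < 2 ^ k := by
        rw [pow_succ] at hk
        by_cases h : (shatteredSubsets P (Y ∩ P j false) S).card < 2 ^ k
        · exact ⟨true, h⟩
        · exact ⟨false, by simp only [Bool.not_false]; omega⟩
      obtain ⟨Φ₁, hc₁, h₁⟩ := ih hRS (k + 1) Y hk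
      obtain ⟨Φ₂, hc₂, h₂⟩ := ih hRS k _ hb
      refine ⟨Φ₁.image (fun f => Function.update f j b) ∪
        Φ₂.image (fun f => Function.update f j (!b)), ?_, fun y hy => ?_⟩
      · rw [Finset.card_insert_of_notMem hjR]
        calc _ ≤ Φ₁.card + Φ₂.card := (Finset.card_union_le _ _).trans
              (add_le_add Finset.card_image_le Finset.card_image_le)
          _ ≤ (R.card + 1) ^ (k + 1) + (R.card + 1) ^ k := add_le_add hc₁ hc₂
          _ = (R.card + 1) ^ k * (R.card + 1 + 1) := by ring
          _ ≤ (R.card + 1 + 1) ^ k * (R.card + 1 + 1) := by gcongr; omega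
          _ = _ := by ring
      · have hupd : ∀ (f : α → Bool) (c : Bool), (∀ i ∈ R, y ∉ P i (!f i)) → y ∉ P j (!c) →
            ∀ i ∈ insert j R, y ∉ P i (!(Function.update f j c) i) := by
          intro f c hf hc i hi
          by_cases hij : i = j
          · subst hij
            simpa using hc
          · simpa [hij] using hf i ((Finset.mem_insert.1 hi).resolve_left hij)
        by_cases hyb : y ∈ P j (!b)
        · obtain ⟨f, hf, hf'⟩ := h₂ y ⟨hy, hyb⟩
          refine ⟨_, Finset.mem_union_right _ (Finset.mem_image_of_mem _ hf), hupd f _ hf' ?_⟩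
          intro hyb'
          have hd := Set.disjoint_left.1 (hP j)
          cases b
          · exact hd (by simpa using hyb') (by simpa using hyb)
          · exact hd (by simpa using hyb) (by simpa using hyb')
        · obtain ⟨f, hf, hf'⟩ := h₁ y hy
          exact ⟨_, Finset.mem_union_left _ (Finset.mem_image_of_mem _ hf), hupd f _ hf' hyb⟩

lemma sum_range_pow_le_succ_pow {n : ℕ} (hn : 1 ≤ n) (d : ℕ) :
    ∑ i ∈ Finset.range d, n ^ i ≤ (n + 1) ^ d := by
  induction d with
  | zero => simp
  | succ d ih =>
    rw [Finset.sum_range_succ]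
    calc _ ≤ (n + 1) ^ d + (n + 1) ^ d * n := by
          refine add_le_add ih ?_
          calc n ^ d ≤ (n + 1) ^ d := Nat.pow_le_pow_left (by omega) d
            _ ≤ (n + 1) ^ d * n := Nat.le_mul_of_pos_right _ hn
      _ = _ := by ring

open Classical in
lemma card_shatteredSubsets_le {Y : Set X} {S : Finset α} {d : ℕ} (hS : 1 ≤ S.card)
    (hd : ∀ B : Finset α, d ≤ B.card → ¬ PatternShatters P Y B) :
    (shatteredSubsets P Y S).card ≤ (S.card + 1) ^ d := by
  have hsub : shatteredSubsets P Y S ⊆ (Finset.range d).biUnion fun i => S.powersetCard i := by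
    intro B hB
    obtain ⟨h1, h2⟩ : B ⊆ S ∧ PatternShatters P Y B := by simpa [shatteredSubsets] using hB
    simp only [Finset.mem_biUnion, Finset.mem_range, Finset.mem_powersetCard]
    exact ⟨B.card, not_le.1 fun h => hd B h h2, h1, rfl⟩
  calc _ ≤ _ := Finset.card_le_card hsub
    _ ≤ ∑ i ∈ Finset.range d, (S.powersetCard i).card := Finset.card_biUnion_le
    _ ≤ ∑ i ∈ Finset.range d, S.card ^ i := Finset.sum_le_sum fun i _ => by
        rw [Finset.card_powersetCard]
        exact Nat.choose_le_pow _ _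
    _ ≤ _ := sum_range_pow_le_succ_pow hS d

end Combinatorics

section Covers

variable {X ι : Type*} {T : X → X} {U : ι → Set X}

open Classical in
lemma exists_subcover_joinCover {S : Finset ℕ} (Φ : Finset (ℕ → ι))
    (h : ∀ x, ∃ f ∈ Φ, ∀ i ∈ S, T^[i] x ∈ U (f i)) :
    ∃ F : Finset (Set X), ↑F ⊆ joinCover T U S ∧ ⋃₀ (F : Set (Set X)) = Set.univ ∧
      F.card ≤ Φ.card := by
  refine ⟨Φ.image fun f => ⋂ i ∈ S, (T^[i]) ⁻¹' (U (f i)), ?_, ?_, Finset.card_image_le⟩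
  · intro A hA
    obtain ⟨f, -, rfl⟩ := Finset.mem_image.1 (Finset.mem_coe.1 hA)
    exact ⟨f, rfl⟩
  · refine Set.eq_univ_of_forall fun x => ?_
    obtain ⟨f, hf, hx⟩ := h x
    exact ⟨⋂ i ∈ S, (T^[i]) ⁻¹' (U (f i)),
      Finset.mem_coe.2 (Finset.mem_image.2 ⟨f, hf, rfl⟩), by simpa using hx⟩

lemma coverN_joinCover_le {S : Finset ℕ} (Φ : Finset (ℕ → ι))
    (h : ∀ x, ∃ f ∈ Φ, ∀ i ∈ S, T^[i] x ∈ U (f i)) :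
    coverN (joinCover T U S) ≤ Φ.card := by
  obtain ⟨F, h1, h2, h3⟩ := exists_subcover_joinCover Φ h
  have hmem : coverN (joinCover T U S) ≤ F.card := Nat.sInf_le ⟨F, h1, h2, rfl⟩
  exact hmem.trans h3

open Classical in
lemma exists_full_family [Fintype ι] [Nonempty X] (hU : (⋃ i, U i) = Set.univ) (S : Finset ℕ) :
    ∃ Φ : Finset (ℕ → ι), Φ.card ≤ Fintype.card ι ^ S.card ∧
      ∀ x, ∃ f ∈ Φ, ∀ i ∈ S, T^[i] x ∈ U (f i) := by
  have hU' : ∀ x, ∃ i, x ∈ U i := fun x => Set.mem_iUnion.1 (hU ▸ Set.mem_univ x)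
  choose g hg using hU'
  obtain ⟨x₀⟩ := ‹Nonempty X›
  refine ⟨(Finset.univ : Finset (S → ι)).image
    fun f j => if hj : j ∈ S then f ⟨j, hj⟩ else g x₀, ?_, fun x => ?_⟩
  · refine Finset.card_image_le.trans ?_
    simp
  · refine ⟨_, Finset.mem_image_of_mem _ (Finset.mem_univ fun j : S => g (T^[j] x)), ?_⟩
    intro i hi
    simpa [hi] using hg (T^[i] x)

lemma coverN_le_pstar [Fintype ι] [Nonempty X] (hU : (⋃ i, U i) = Set.univ) (S : Finset ℕ) :
    coverN (joinCover T U S) ≤ pstar T U S.card := by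
  refine le_csSup ⟨Fintype.card ι ^ S.card, ?_⟩ ⟨S, rfl, rfl⟩
  rintro _ ⟨S', hS', rfl⟩
  obtain ⟨Φ, h1, h2⟩ := exists_full_family (T := T) hU S'
  exact (coverN_joinCover_le Φ h2).trans (hS' ▸ h1)

lemma pstar_le {n M : ℕ} (h : ∀ S : Finset ℕ, S.card = n → coverN (joinCover T U S) ≤ M) :
    pstar T U n ≤ M := by
  obtain ⟨S, hS⟩ : ∃ S : Finset ℕ, S.card = n := ⟨Finset.range n, by simp⟩
  refine csSup_le ⟨_, S, hS, rfl⟩ ?_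
  rintro _ ⟨S, hS, rfl⟩
  exact h S hS

/-- The complements of the preimages of the two members of a cover. -/
def complPattern {X : Type*} (T : X → X) (V : Bool → Set X) (j : ℕ) (b : Bool) : Set X :=
  ((T^[j]) ⁻¹' (V b))ᶜ

open Classical in
lemma two_pow_le_coverN [Nonempty X] {e : Bool ≃ ι} [Fintype ι] (hU : (⋃ i, U i) = Set.univ)
    {B : Finset ℕ} (hB : PatternShatters (complPattern T (U ∘ e)) Set.univ B) :
    2 ^ B.card ≤ coverN (joinCover T U B) := by
  obtain ⟨Φ, -, hΦ⟩ := exists_full_family (T := T) hU B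
  obtain ⟨F₀, hF₀, hF₀', -⟩ := exists_subcover_joinCover Φ hΦ
  refine le_csInf ⟨_, F₀, hF₀, hF₀', rfl⟩ ?_
  rintro _ ⟨F, hF, hF', rfl⟩
  choose x _ hx using hB
  have hcov : ∀ C : Finset ℕ, ∃ A ∈ F, x (fun j => decide (j ∈ C)) ∈ A := fun C => by
    simpa using (hF' ▸ Set.mem_univ (x fun j => decide (j ∈ C)) :
      x (fun j => decide (j ∈ C)) ∈ ⋃₀ (F : Set (Set X)))
  choose A hAF hxA using hcov
  rw [← Finset.card_powerset]
  refine Finset.card_le_card_of_injOn A (fun C _ => hAF C) fun C hC D hD hCD => ?_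
  obtain ⟨f, hf⟩ := hF (hAF C)
  have hval : ∀ E : Finset ℕ, A E = A C → ∀ j ∈ B, decide (j ∈ E) = !e.symm (f j) := by
    intro E hE j hj
    have h1 : x (fun j => decide (j ∈ E)) ∈ A C := hE ▸ hxA E
    rw [hf] at h1
    have h2 := Set.mem_iInter₂.1 h1 j hj
    have h3 := hx (fun j => decide (j ∈ E)) j hj
    have hne : decide (j ∈ E) ≠ e.symm (f j) := by
      intro heq
      simp only [complPattern, heq, Function.comp, Equiv.apply_symm_apply] at h3
      exact h3 h2
    revert hne
    cases decide (j ∈ E) <;> cases e.symm (f j) <;> simp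
  have hC' := Finset.mem_powerset.1 (Finset.mem_coe.1 hC)
  have hD' := Finset.mem_powerset.1 (Finset.mem_coe.1 hD)
  ext j
  by_cases hj : j ∈ B
  · have := (hval C rfl j hj).trans (hval D hCD.symm j hj).symm
    simpa using this
  · exact iff_of_false (fun h => hj (hC' h)) fun h => hj (hD' h)

/-- If, for a shrinking `K` of `U`, the pairs `(U i)ᶜ, K i` shatter no set of size at least `d`,
then the joins of `U` over `n`-element sets have quasi-polynomially many members. -/
lemma pstar_le_of_not_patternShatters [Fintype ι] [Nonempty X] {K : ι → Set X}
    (hK : (⋃ i, K i) = Set.univ) (hKU : ∀ i, K i ⊆ U i) {d : ℕ}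
    (hd : ∀ i, ∀ B : Finset ℕ, d ≤ B.card →
      ¬ PatternShatters (complPattern T fun b => bif b then U i else (K i)ᶜ) Set.univ B)
    {n k : ℕ} (hn : 1 ≤ n) (hk : (n + 1) ^ d < 2 ^ k) :
    pstar T U n ≤ ((n + 1) ^ k) ^ Fintype.card ι := by
  classical
  refine pstar_le fun S hS => ?_
  have hdisj : ∀ i j, Disjoint (complPattern T (fun b => bif b then U i else (K i)ᶜ) j false)
      (complPattern T (fun b => bif b then U i else (K i)ᶜ) j true) := by
    intro i j
    refine Set.disjoint_left.2 fun x h1 h2 => ?_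
    simp only [complPattern, cond_false, cond_true, Set.mem_compl_iff, Set.mem_preimage,
      not_not] at h1 h2
    exact h2 (hKU i h1)
  have hfam := fun i => exists_extension_family (hdisj i) S subset_rfl k Set.univ
    ((card_shatteredSubsets_le (hS ▸ hn) (hd i)).trans_lt (hS ▸ hk))
  choose Φ hcard hΦ using hfam
  have hK' : ∀ x, ∃ i, x ∈ K i := fun x => Set.mem_iUnion.1 (hK ▸ Set.mem_univ x)
  obtain ⟨x₀⟩ := ‹Nonempty X›
  obtain ⟨i₀, -⟩ := hK' x₀
  let G : (ι → ℕ → Bool) → ℕ → ι := fun f j =>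
    if h : ∃ i, f i j = false then h.choose else i₀
  have hle : coverN (joinCover T U S) ≤ ((Fintype.piFinset Φ).image G).card := by
    refine coverN_joinCover_le _ fun x => ?_
    choose f hf hfx using fun i => hΦ i x (Set.mem_univ x)
    refine ⟨_, Finset.mem_image_of_mem G (Fintype.mem_piFinset.2 hf), fun j hj => ?_⟩
    have hex : ∃ i, f i j = false := by
      obtain ⟨i, hi⟩ := hK' (T^[j] x)
      refine ⟨i, ?_⟩
      by_contra hne
      have := hfx i j hj
      simp [complPattern, Bool.eq_true_of_not_eq_false hne] at this
      exact this hi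
    have hG : G f j = hex.choose := dif_pos hex
    have := hfx hex.choose j hj
    rw [hex.choose_spec] at this
    rw [hG]
    simpa [complPattern] using this
  calc _ ≤ _ := hle
    _ ≤ (Fintype.piFinset Φ).card := Finset.card_image_le
    _ = ∏ i, (Φ i).card := Fintype.card_piFinset _
    _ ≤ ∏ _i : ι, (n + 1) ^ k := Finset.prod_le_prod' fun i _ => hS ▸ hcard i
    _ = _ := by simp

end Covers

lemma natCast_pow_le_rpow_log {n m d : ℕ} (hn : 2 ≤ n) :
    ((((n + 1) ^ (d * (Nat.log 2 (n + 1) + 1))) ^ m : ℕ) : ℝ)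
      ≤ (n : ℝ) ^ ((6 * d * m + 1 : ℝ) * Real.logb 2 (n : ℝ)) := by
  have hn' : (2 : ℝ) ≤ n := by exact_mod_cast hn
  have hsq : (n : ℝ) + 1 ≤ (n : ℝ) ^ 2 := by nlinarith
  have hl1 : 1 ≤ Real.logb 2 (n : ℝ) := by
    rw [Real.le_logb_iff_rpow_le (by norm_num) (by linarith)]
    simpa using hn'
  have hl2 : (Nat.log 2 (n + 1) : ℝ) ≤ 2 * Real.logb 2 (n : ℝ) := by
    calc (Nat.log 2 (n + 1) : ℝ) ≤ Real.logb 2 ((n + 1 : ℕ) : ℝ) := Real.natLog_le_logb _ _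
      _ ≤ Real.logb 2 ((n : ℝ) ^ 2) := by
        push_cast
        exact Real.logb_le_logb_of_le (by norm_num) (by linarith) hsq
      _ = _ := by rw [Real.logb_pow]; norm_num
  push_cast
  rw [← pow_mul]
  calc ((n : ℝ) + 1) ^ (d * (Nat.log 2 (n + 1) + 1) * m)
      ≤ ((n : ℝ) ^ 2) ^ (d * (Nat.log 2 (n + 1) + 1) * m) :=
        pow_le_pow_left₀ (by linarith) hsq _
    _ = (n : ℝ) ^ ((2 * (d * (Nat.log 2 (n + 1) + 1) * m) : ℕ) : ℝ) := by
        rw [Real.rpow_natCast, pow_mul (n : ℝ) 2]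
    _ ≤ _ := by
        refine Real.rpow_le_rpow_of_exponent_le (by linarith) ?_
        push_cast
        have h3 : (Nat.log 2 (n + 1) : ℝ) + 1 ≤ 3 * Real.logb 2 (n : ℝ) := by linarith
        have h4 := mul_le_mul_of_nonneg_left h3 (by positivity : (0 : ℝ) ≤ 2 * d * m)
        nlinarith

/-- **Theorem 1.2.** Let `(X,T)` be a null topological dynamical system, i.e.
`(1/n)·log₂ p*_{X,U}(n) → 0` for every finite open cover `U` of `X`. Then for every
finite open cover `U` of `X` there is a constant `c = c(U) > 0` such that
`p*_{X,U}(n) ≤ n^{c·log₂ n}` for every `n ≥ 2`. -/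
theorem stmt15 {X : Type*} [TopologicalSpace X] [CompactSpace X]
    [TopologicalSpace.MetrizableSpace X] [Nonempty X]
    (T : X → X) (hT : Continuous T)
    (hnull : ∀ (m : ℕ) (U : Fin m → Set X), (∀ i, IsOpen (U i)) →
      (⋃ i, U i) = Set.univ →
      Tendsto (fun n : ℕ => Real.logb 2 (pstar T U n) / (n : ℝ)) atTop (nhds 0)) :
    ∀ (m : ℕ) (U : Fin m → Set X), (∀ i, IsOpen (U i)) → (⋃ i, U i) = Set.univ →
      ∃ c : ℝ, 0 < c ∧ ∀ n : ℕ, 2 ≤ n →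
        (pstar T U n : ℝ) ≤ (n : ℝ) ^ (c * Real.logb 2 (n : ℝ)) := by
  intro m U hUo hU
  obtain ⟨K, hK, hKc, hKU⟩ := exists_iUnion_eq_closed_subset hUo (fun _ => Set.toFinite _) hU
  let W : Fin m → Bool → Set X := fun i b => bif b then U i else (K i)ᶜ
  let e : Bool ≃ Fin 2 := finTwoEquiv.symm
  have hW : ∀ i, (⋃ j, (W i ∘ e.symm) j) = Set.univ := fun i => by
    refine Set.eq_univ_of_forall fun x => Set.mem_iUnion.2 ?_
    by_cases hx : x ∈ K i
    · exact ⟨e true, by simpa [W] using hKU i hx⟩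
    · exact ⟨e false, by simpa [W] using hx⟩
  have hWo : ∀ i j, IsOpen ((W i ∘ e.symm) j) := fun i j => by
    simp only [Function.comp, W]
    cases e.symm j
    · exact (hKc i).isOpen_compl
    · exact hUo i
  have hev : ∀ᶠ n : ℕ in atTop,
      ∀ i, Real.logb 2 (pstar T (W i ∘ e.symm) n) / (n : ℝ) < 1 :=
    eventually_all.2 fun i =>
      (hnull 2 (W i ∘ e.symm) (hWo i) (hW i)).eventually_lt_const one_pos
  obtain ⟨d₀, hd₀⟩ := eventually_atTop.1 hev
  have hns : ∀ i, ∀ B : Finset ℕ, d₀ + 1 ≤ B.card →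
      ¬ PatternShatters (complPattern T (W i)) Set.univ B := by
    intro i B hB hsh
    have h1 : 2 ^ B.card ≤ pstar T (W i ∘ e.symm) B.card :=
      (two_pow_le_coverN (e := e) (hW i)
        (by simpa [Function.comp_def] using hsh)).trans (coverN_le_pstar (hW i) B)
    have h2 := hd₀ B.card (by omega) i
    have hpos : (0 : ℝ) < B.card := by
      have : 0 < B.card := by omega
      exact_mod_cast this
    rw [div_lt_one hpos] at h2
    have h3 : (2 : ℝ) ^ (B.card : ℝ) ≤ pstar T (W i ∘ e.symm) B.card := by
      rw [Real.rpow_natCast]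
      exact_mod_cast h1
    exact absurd h2 (not_lt.2 ((Real.le_logb_iff_rpow_le (by norm_num)
      (lt_of_lt_of_le (by positivity) h3)).2 h3))
  refine ⟨6 * (d₀ + 1 : ℕ) * m + 1, by positivity, fun n hn => ?_⟩
  have hk : (n + 1) ^ (d₀ + 1) < 2 ^ ((d₀ + 1) * (Nat.log 2 (n + 1) + 1)) := by
    rw [mul_comm, pow_mul]
    exact Nat.pow_lt_pow_left (Nat.lt_pow_succ_log_self (by norm_num) _) (by omega)
  have hp := pstar_le_of_not_patternShatters hK hKU hns (by omega : 1 ≤ n) hk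
  rw [Fintype.card_fin] at hp
  exact (Nat.cast_le.2 hp).trans (natCast_pow_le_rpow_log hn)
end

section
/- Let (X,T) be a topological dynamical system, let V = {V_1, V_2} be an open cover of X, and let S be a nonempty finite subset of ℕ∪{0}. For each x ∈ X define the partial function h_x : S → {1,2,⋆} by h_x(i) = 1 if x ∈ T^{-i}(X∖V_1), h_x(i) = 2 if x ∈ T^{-i}(X∖V_2), and h_x(i) = ⋆ otherwise (this is well defined since X∖V_1 and X∖V_2 are disjoint), and let H = {h_x : x ∈ X}. Then C(H) = N(⋁_{i∈S} T^{-i}V). -/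
open Filter Topology
open scoped ENNReal

/-- The joint `⋁_{i ∈ S} T^{-i} U` consists of the sets determined by functions on `S`. -/
theorem mem_joinCover_iff {X ι : Type*} [Nonempty ι] (T : X → X) (U : ι → Set X)
    (S : Finset ℕ) (A : Set X) :
    A ∈ joinCover T U S ↔ ∃ f : S → ι, A = {x | ∀ i : S, T^[(i : ℕ)] x ∈ U (f i)} := by
  classical
  constructor
  · rintro ⟨f, rfl⟩
    refine ⟨fun i => f i, ?_⟩
    ext x
    simp
  · rintro ⟨f, rfl⟩
    refine ⟨fun i => if h : i ∈ S then f ⟨i, h⟩ else Classical.arbitrary ι, ?_⟩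
    ext x
    simp only [Set.mem_ofPred_eq, Subtype.forall, Set.mem_iInter, Set.mem_preimage]
    refine forall₂_congr fun i hi => ?_
    rw [dif_pos hi]

/-- If the partial functions `h x` are avoided by `f` exactly when `x` lies in the member of the
joint given by `f`, then the covering number of the class equals the minimum size of a subcover
of the joint. -/
theorem coveringNumber_range_eq_coverN_joinCover {X ι : Type*} [Fintype ι] [Nonempty ι]
    (T : X → X) (U : ι → Set X) (hU : ⋃ i, U i = Set.univ) (S : Finset ℕ)
    (h : X → S → Option ι)
    (hh : ∀ x i a, h x i ≠ some a ↔ T^[(i : ℕ)] x ∈ U a) :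
    coveringNumber (Set.range h) = coverN (joinCover T U S) := by
  classical
  have cover_of_net : ∀ F : Finset (S → ι), IsNet (Set.range h) F →
      ∃ G : Finset (Set X), ↑G ⊆ joinCover T U S ∧ ⋃₀ (G : Set (Set X)) = Set.univ ∧
        G.card ≤ F.card := by
    intro F hF
    refine ⟨F.image fun f => {x | ∀ i : S, T^[(i : ℕ)] x ∈ U (f i)}, ?_, ?_,
      Finset.card_image_le⟩
    · intro A hA
      obtain ⟨f, -, rfl⟩ := Finset.mem_image.1 (Finset.mem_coe.1 hA)
      exact (mem_joinCover_iff T U S _).2 ⟨f, rfl⟩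
    · refine Set.eq_univ_of_forall fun x => ?_
      obtain ⟨f, hf, hx⟩ := hF (h x) ⟨x, rfl⟩
      exact ⟨_, Finset.mem_coe.2 (Finset.mem_image_of_mem _ hf), fun i => (hh x i _).1 (hx i)⟩
  have net_of_cover : ∀ G : Finset (Set X), ↑G ⊆ joinCover T U S →
      ⋃₀ (G : Set (Set X)) = Set.univ →
      ∃ F : Finset (S → ι), IsNet (Set.range h) F ∧ F.card ≤ G.card := by
    intro G hG hGX
    choose! c hc using fun A (hA : A ∈ G) => (mem_joinCover_iff T U S A).1 (hG hA)
    refine ⟨G.image c, ?_, Finset.card_image_le⟩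
    rintro _ ⟨x, rfl⟩
    obtain ⟨A, hA, hx⟩ := Set.mem_sUnion.1 (hGX ▸ Set.mem_univ x)
    rw [hc A hA] at hx
    exact ⟨c A, Finset.mem_image_of_mem _ hA, fun i => (hh x i _).2 (hx i)⟩
  have univ_net : IsNet (Set.range h) Finset.univ := by
    rintro _ ⟨x, rfl⟩
    have hx : ∀ i : S, ∃ a, T^[(i : ℕ)] x ∈ U a := fun i =>
      Set.mem_iUnion.1 (hU ▸ Set.mem_univ _)
    choose f hf using hx
    exact ⟨f, Finset.mem_univ _, fun i => (hh x i _).2 (hf i)⟩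
  apply le_antisymm
  · obtain ⟨G₀, hG₀, hG₀X, -⟩ := cover_of_net _ univ_net
    refine le_csInf ⟨_, G₀, hG₀, hG₀X, rfl⟩ ?_
    rintro _ ⟨G, hG, hGX, rfl⟩
    obtain ⟨F, hF, hcard⟩ := net_of_cover G hG hGX
    exact le_trans (Nat.sInf_le ⟨F, hF, rfl⟩) hcard
  · refine le_csInf ⟨_, _, univ_net, rfl⟩ ?_
    rintro _ ⟨F, hF, rfl⟩
    obtain ⟨G, hG, hGX, hcard⟩ := cover_of_net F hF
    exact le_trans (Nat.sInf_le ⟨G, hG, hGX, rfl⟩) hcard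

open scoped Classical in
/-- **Claim A.2.** Let `(X,T)` be a topological dynamical system, `V = {V 0, V 1}` an
open cover of `X`, and `S ⊆ ℕ ∪ {0}` nonempty and finite. For `x ∈ X` define the partial
function `h_x : S → {1,2,⋆}` by `h_x i = 1` if `x ∈ T^{-i}(X ∖ V 0)`, `h_x i = 2` if
`x ∈ T^{-i}(X ∖ V 1)`, and `h_x i = ⋆` otherwise (well defined as the two complements
are disjoint). Then for `H = {h_x : x ∈ X}` one has `C(H) = N(⋁_{i ∈ S} T^{-i} V)`. -/
theorem stmt16 {X : Type*} [TopologicalSpace X] [CompactSpace X]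
    [TopologicalSpace.MetrizableSpace X] [Nonempty X]
    (T : X → X) (hT : Continuous T) (V : Fin 2 → Set X)
    (hopen : ∀ i, IsOpen (V i)) (hcover : ⋃ i, V i = Set.univ)
    (S : Finset ℕ) (hS : S.Nonempty) :
    coveringNumber
      {h : S → Option (Fin 2) | ∃ x : X,
        h = fun i : S => if x ∈ (T^[(i : ℕ)]) ⁻¹' (V 0)ᶜ then (some 0 : Option (Fin 2))
          else if x ∈ (T^[(i : ℕ)]) ⁻¹' (V 1)ᶜ then some 1 else none} =
      coverN (joinCover T V S) := by
  have key : ∀ (x : X) (i : S) (a : Fin 2),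
      (if x ∈ (T^[(i : ℕ)]) ⁻¹' (V 0)ᶜ then (some 0 : Option (Fin 2))
        else if x ∈ (T^[(i : ℕ)]) ⁻¹' (V 1)ᶜ then some 1 else none) ≠ some a ↔
        T^[(i : ℕ)] x ∈ V a := by
    intro x i a
    have hx : T^[(i : ℕ)] x ∈ V 0 ∨ T^[(i : ℕ)] x ∈ V 1 := by
      have := Set.mem_iUnion.1 (hcover ▸ Set.mem_univ (T^[(i : ℕ)] x))
      simpa [Fin.exists_fin_two] using this
    by_cases h0 : T^[(i : ℕ)] x ∈ V 0 <;> by_cases h1 : T^[(i : ℕ)] x ∈ V 1 <;>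
      fin_cases a <;> simp_all
  rw [← coveringNumber_range_eq_coverN_joinCover T V hcover S _ key]
  congr 1
  ext h
  simp only [Set.mem_ofPred_eq, Set.mem_range, eq_comm]
end
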